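/- arXiv:1811.05174 — 2 statements merged into one kernel-verified Lean document; each statement's English description precedes it below -/
import Mathlib

section
/- Let γ > −1 and let φ be a symbol inducing a bounded composition operator C_φ: B_γ → H². Then there is a constant C > 0 such that for all n ≥ 1: a_n(C_φ: B_γ → H²) ≤ C · inf_{0<h<1} ( (n+1)^{(γ+1)/2} e^{−n h} + sup_{0<t≤h} √( ρ_φ(t)/t^{2+γ} ) ). -/
open Complex MeasureTheory Set Filter
open scoped ENNReal Topology

noncomputable section

/-- The open unit disk in `ℂ`. -/
def unitDisk : Set ℂ := Metric.ball (0 : ℂ) 1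

/-- A symbol: a non-constant analytic self-map of the unit disk. -/
structure IsSymbol (φ : ℂ → ℂ) : Prop where
  mapsTo : Set.MapsTo φ unitDisk unitDisk
  diff : DifferentiableOn ℂ φ unitDisk
  nonconst : ¬ ∃ c : ℂ, Set.EqOn φ (fun _ => c) unitDisk

/-- `φ` is `p`-valent: every `w ∈ 𝔻` has at most `p` preimages in `𝔻`. -/
def Valent (φ : ℂ → ℂ) (p : ℕ) : Prop :=
  ∀ w ∈ unitDisk, (unitDisk ∩ φ ⁻¹' {w}).encard ≤ p

/-- The radial limit of `φ` at the boundary point `toCircle θ` exists and equals `w`.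
The circle `𝕋` is parametrized by `AddCircle 1` (so that `volume` is the normalized
Haar measure `m`). -/
def HasRadialLimit (φ : ℂ → ℂ) (θ : AddCircle (1 : ℝ)) (w : ℂ) : Prop :=
  Filter.Tendsto (fun r : ℝ => φ (r * (AddCircle.toCircle θ : ℂ)))
    (nhdsWithin 1 (Set.Iio 1)) (nhds w)

/-- The pull-back measure `m_φ(S) = m({ξ : φ*(ξ) ∈ S})`. -/
def pullbackMeasure (φ : ℂ → ℂ) (S : Set ℂ) : ℝ≥0∞ :=
  volume {θ : AddCircle (1 : ℝ) | ∃ w ∈ S, HasRadialLimit φ θ w}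

/-- `ρ_φ(h) = sup_{ξ ∈ 𝕋} m_φ[S(ξ,h)]`, where `S(ξ,h) = {z : |z - ξ| ≤ h}`. -/
def rho (φ : ℂ → ℂ) (h : ℝ) : ℝ≥0∞ :=
  ⨆ ξ : Circle, pullbackMeasure φ {z : ℂ | ‖z - (ξ : ℂ)‖ ≤ h}

/-- The `n`-th approximation number of a bounded operator between normed spaces:
the distance of `T` to operators of rank `< n`. -/
def approxNum {E F : Type*} [NormedAddCommGroup E] [NormedAddCommGroup F]
    [NormedSpace ℂ E] [NormedSpace ℂ F] (n : ℕ) (T : E →L[ℂ] F) : ℝ :=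
  sInf {c : ℝ | ∃ R : E →L[ℂ] F,
    Module.rank ℂ (LinearMap.range (R : E →ₗ[ℂ] F)) < (n : Cardinal) ∧ c = ‖T - R‖}

/-- The Hardy space `H²(𝔻)` in its coefficient model `ℓ²(ℕ)`. -/
abbrev H2 := lp (fun _ : ℕ => ℂ) 2

/-- The analytic function on `𝔻` associated with an element of `H²`. -/
def H2.eval (a : H2) (z : ℂ) : ℂ := ∑' n : ℕ, a n * z ^ n

/-- `T` is the composition operator with symbol `φ` on `H²(𝔻)`. -/
def IsCompOp (φ : ℂ → ℂ) (T : H2 →L[ℂ] H2) : Prop :=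
  ∀ a : H2, ∀ z ∈ unitDisk, H2.eval (T a) z = H2.eval a (φ z)

/-- The open unit polydisk `𝔻^N`. -/
def polyDisk (N : ℕ) : Set (Fin N → ℂ) := {z | ∀ i, ‖z i‖ < 1}

/-- The Hardy space `H²(𝔻^N)` in its coefficient model `ℓ²(ℕ^N)`. -/
abbrev H2poly (N : ℕ) := lp (fun _ : Fin N → ℕ => ℂ) 2

/-- The analytic function on `𝔻^N` associated with an element of `H²(𝔻^N)`. -/
def H2poly.eval {N : ℕ} (a : H2poly N) (z : Fin N → ℂ) : ℂ :=
  ∑' α : Fin N → ℕ, a α * ∏ i, z i ^ α i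

/-- `T` is the composition operator with symbol `Φ` on `H²(𝔻^N)`. -/
def IsCompOpPoly {N : ℕ} (Φ : (Fin N → ℂ) → (Fin N → ℂ))
    (T : H2poly N →L[ℂ] H2poly N) : Prop :=
  ∀ a : H2poly N, ∀ z ∈ polyDisk N, H2poly.eval (T a) z = H2poly.eval a (Φ z)

/-- The lens map `λ_θ`. -/
def lens (θ : ℝ) (z : ℂ) : ℂ :=
  ((1 + z) ^ (θ : ℂ) - (1 - z) ^ (θ : ℂ)) / ((1 + z) ^ (θ : ℂ) + (1 - z) ^ (θ : ℂ))

/-- `T : H² → H²` represents the composition operator `C_φ : B_γ → H²` in the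
coefficient model of the weighted Bergman space `B_γ`, where `b ∈ ℓ²` corresponds to
the function `f(z) = ∑ b_n (n+1)^{(γ+1)/2} zⁿ` of `B_γ`-norm `‖b‖`. -/
def IsCompOpBergman (γ : ℝ) (φ : ℂ → ℂ) (T : H2 →L[ℂ] H2) : Prop :=
  ∀ b : H2, ∀ z ∈ unitDisk,
    H2.eval (T b) z = ∑' n : ℕ, b n * ((((n : ℝ) + 1) ^ ((γ + 1) / 2) : ℝ) : ℂ) * φ z ^ n

/-- The isometry sending a coefficient sequence to the boundary function with these nonnegative
Fourier coefficients. -/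
def boundaryL2 : H2 →ₗᵢ[ℂ] Lp ℂ 2 (@AddCircle.haarAddCircle (1 : ℝ) _) :=
  ((orthonormal_fourier (T := (1 : ℝ))).comp (fun n : ℕ => (n : ℤ))
    Nat.cast_injective).orthogonalFamily.linearIsometry

lemma hasSum_boundaryL2 (a : H2) :
    HasSum (fun n : ℕ => a n • @fourierLp (1 : ℝ) _ 2 _ (n : ℤ)) (boundaryL2 a) :=
  OrthogonalFamily.hasSum_linearIsometry _ a

lemma fourierCoeff_boundaryL2 (a : H2) (k : ℤ) :
    fourierCoeff (boundaryL2 a) k = if 0 ≤ k then a k.toNat else 0 := by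
  rw [← fourierBasis_repr, HilbertBasis.repr_apply_apply, coe_fourierBasis]
  have h := (hasSum_boundaryL2 a).mapL (innerSL ℂ (@fourierLp (1 : ℝ) _ 2 _ k))
  simp only [map_smul, innerSL_apply_apply, smul_eq_mul] at h
  have ho := orthonormal_iff_ite.1 (orthonormal_fourier (T := (1 : ℝ)))
  simp only [ho] at h
  rw [← h.tsum_eq]
  split_ifs with hk
  · rw [tsum_eq_single k.toNat]
    · simp [hk]
    · intro n hn
      rw [if_neg (by omega), mul_zero]
  · convert tsum_zero with n
    rw [if_neg (by omega), mul_zero]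

/-- The Poisson kernel of the disk, as a function on the additive circle. -/
def poissonCircle (r : ℝ) (t : AddCircle (1 : ℝ)) : ℝ :=
  (1 - r ^ 2) / ‖1 - (r : ℂ) * (AddCircle.toCircle t : ℂ)‖ ^ 2

lemma fourier_natCast_apply (n : ℕ) (t : AddCircle (1 : ℝ)) :
    fourier (n : ℤ) t = (AddCircle.toCircle t : ℂ) ^ n := by
  simp [fourier_apply, AddCircle.toCircle_nsmul]

lemma poissonCircle_eq_tsum {r : ℝ} (h0 : 0 ≤ r) (h1 : r < 1) (t : AddCircle (1 : ℝ)) :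
    (poissonCircle r t : ℂ) = ∑' n : ℕ, (r : ℂ) ^ n * fourier (n : ℤ) t +
      ∑' n : ℕ, (r : ℂ) ^ (n + 1) * fourier (-((n : ℤ) + 1)) t := by
  set ζ : ℂ := (AddCircle.toCircle t : ℂ) with hζ
  have hn : ‖ζ‖ = 1 := Circle.norm_coe _
  have hr : ‖(r : ℂ) * ζ‖ < 1 := by simpa [hn, abs_of_nonneg h0] using h1
  have hr' : ‖(r : ℂ) * (starRingEnd ℂ) ζ‖ < 1 := by simpa [hn, abs_of_nonneg h0] using h1
  have e1 : ∀ n : ℕ, (r : ℂ) ^ n * fourier (n : ℤ) t = (r * ζ) ^ n := fun n => by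
    rw [fourier_natCast_apply, mul_pow]
  have e2 : ∀ n : ℕ, (r : ℂ) ^ (n + 1) * fourier (-((n : ℤ) + 1)) t =
      (r * (starRingEnd ℂ) ζ) ^ n * (r * (starRingEnd ℂ) ζ) := fun n => by
    rw [fourier_neg, ← Nat.cast_succ, fourier_natCast_apply, ← pow_succ, mul_pow, map_pow]
  simp_rw [e1, e2]
  rw [tsum_mul_right, tsum_geometric_of_norm_lt_one hr, tsum_geometric_of_norm_lt_one hr']
  have hne : ∀ z : ℂ, ‖z‖ < 1 → 1 - z ≠ 0 := fun z hz h => by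
    rw [← sub_eq_zero.1 h] at hz; simp at hz
  have hd := hne _ hr
  have hd' := hne _ hr'
  have hζζ : ζ * (starRingEnd ℂ) ζ = 1 := by
    rw [Complex.mul_conj, Complex.normSq_eq_norm_sq, hn]; simp
  have hnorm : ((‖1 - (r : ℂ) * ζ‖ ^ 2 : ℝ) : ℂ) = (1 - r * ζ) * (1 - r * (starRingEnd ℂ) ζ) := by
    rw [← Complex.normSq_eq_norm_sq, ← Complex.mul_conj]
    simp
  rw [poissonCircle, Complex.ofReal_div, hnorm]
  field_simp
  push_cast
  linear_combination ((r : ℂ) ^ 2) * hζζ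

lemma integral_tsum_fourier_mul {F : AddCircle (1 : ℝ) → ℂ}
    (hF : Integrable F AddCircle.haarAddCircle) {c : ℕ → ℂ} (hc : Summable fun n => ‖c n‖)
    (m : ℕ → ℤ) (θ : AddCircle (1 : ℝ)) :
    Integrable (fun τ => (∑' n, c n * fourier (m n) (θ - τ)) * F τ) AddCircle.haarAddCircle ∧
    ∫ τ, (∑' n, c n * fourier (m n) (θ - τ)) * F τ ∂AddCircle.haarAddCircle =
      ∑' n, c n * fourier (m n) θ * fourierCoeff F (m n) := by
  have hb : ∀ n τ, ‖c n * fourier (m n) (θ - τ)‖ = ‖c n‖ := fun n τ => by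
    rw [norm_mul, fourier_apply, Circle.norm_coe, mul_one]
  have hcont : Continuous fun τ => ∑' n, c n * fourier (m n) (θ - τ) := by
    refine continuous_tsum (fun n => ?_) hc (fun n τ => (hb n τ).le)
    exact continuous_const.mul ((fourier (m n)).continuous.comp (continuous_const.sub continuous_id))
  refine ⟨?_, ?_⟩
  · refine hF.bdd_mul (c := ∑' n, ‖c n‖) hcont.aestronglyMeasurable (Eventually.of_forall fun τ => ?_)
    refine (norm_tsum_le_tsum_norm (by simpa only [hb] using hc)).trans ?_
    simp only [hb, le_refl]
  · have hterm : ∀ n, Integrable (fun τ => c n * fourier (m n) (θ - τ) * F τ)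
        AddCircle.haarAddCircle := fun n =>
      hF.bdd_mul (c := ‖c n‖) (continuous_const.mul ((fourier (m n)).continuous.comp
        (continuous_const.sub continuous_id))).aestronglyMeasurable
        (Eventually.of_forall fun τ => (hb n τ).le)
    have key := integral_tsum_of_summable_integral_norm hterm (by
      simp only [norm_mul, fourier_apply, Circle.norm_coe, mul_one]
      simp_rw [integral_const_mul]
      exact hc.mul_right _)
    simp_rw [tsum_mul_right] at key
    rw [← key]
    refine tsum_congr fun n => ?_
    rw [fourierCoeff, ← integral_const_mul]
    refine integral_congr_ae (Eventually.of_forall fun τ => ?_)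
    have : fourier (m n) (θ - τ) = fourier (m n) θ * fourier (-(m n)) τ := by
      rw [sub_eq_add_neg]
      simp only [fourier_apply, smul_add, AddCircle.toCircle_add, neg_smul, smul_neg, Circle.coe_mul]
    simp only [this, smul_eq_mul]
    ring

lemma integral_poissonCircle_mul {F : AddCircle (1 : ℝ) → ℂ}
    (hF : Integrable F AddCircle.haarAddCircle) {r : ℝ} (h0 : 0 ≤ r) (h1 : r < 1)
    (θ : AddCircle (1 : ℝ)) :
    Integrable (fun τ => (poissonCircle r (θ - τ) : ℂ) * F τ) AddCircle.haarAddCircle ∧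
    ∫ τ, (poissonCircle r (θ - τ) : ℂ) * F τ ∂AddCircle.haarAddCircle =
      ∑' n : ℕ, (r : ℂ) ^ n * fourier (n : ℤ) θ * fourierCoeff F n +
      ∑' n : ℕ, (r : ℂ) ^ (n + 1) * fourier (-((n : ℤ) + 1)) θ *
        fourierCoeff F (-((n : ℤ) + 1)) := by
  have s1 : Summable fun n : ℕ => ‖(r : ℂ) ^ n‖ := by
    simpa [abs_of_nonneg h0] using summable_geometric_of_lt_one h0 h1
  have s2 : Summable fun n : ℕ => ‖(r : ℂ) ^ (n + 1)‖ := (summable_nat_add_iff 1).2 s1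
  obtain ⟨i1, t1⟩ := integral_tsum_fourier_mul hF s1 (fun n => (n : ℤ)) θ
  obtain ⟨i2, t2⟩ := integral_tsum_fourier_mul hF s2 (fun n => -((n : ℤ) + 1)) θ
  simp_rw [poissonCircle_eq_tsum h0 h1, add_mul]
  exact ⟨i1.add i2, by rw [integral_add i1 i2, t1, t2]⟩

lemma H2.eval_eq_integral (a : H2) {r : ℝ} (h0 : 0 ≤ r) (h1 : r < 1) (θ : AddCircle (1 : ℝ))
    (hF : Integrable (boundaryL2 a) AddCircle.haarAddCircle) :
    H2.eval a (r * (AddCircle.toCircle θ : ℂ)) =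
      ∫ τ, (poissonCircle r (θ - τ) : ℂ) * boundaryL2 a τ ∂AddCircle.haarAddCircle := by
  rw [(integral_poissonCircle_mul hF h0 h1 θ).2, H2.eval]
  simp_rw [fourierCoeff_boundaryL2, fourier_natCast_apply]
  have : ∀ n : ℕ, ¬ (0 ≤ -((n : ℤ) + 1)) := fun n => by omega
  simp only [this, if_false, mul_zero, tsum_zero, add_zero]
  refine tsum_congr fun n => ?_
  simp
  ring

lemma integral_poissonCircle {r : ℝ} (h0 : 0 ≤ r) (h1 : r < 1) (θ : AddCircle (1 : ℝ)) :
    ∫ τ, (poissonCircle r (θ - τ) : ℂ) ∂AddCircle.haarAddCircle = 1 := by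
  have h := (integral_poissonCircle_mul (F := fourier 0)
    ((fourier (T := 1) 0).continuous.integrable_of_hasCompactSupport
      (HasCompactSupport.of_compactSpace _)) h0 h1 θ).2
  simp only [fourier_zero, mul_one, fourierCoeff_fourier] at h
  rw [h, tsum_eq_single 0]
  · have : ∀ n : ℕ, (Pi.single 0 1 : ℤ → ℂ) (-((n : ℤ) + 1)) = 0 := fun n =>
      Pi.single_eq_of_ne (by omega) _
    simp only [this, mul_zero, tsum_zero, add_zero]
    simp
  · intro n hn
    simp [hn]

lemma haarAddCircle_one_eq_volume :
    (AddCircle.haarAddCircle : Measure (AddCircle (1 : ℝ))) = volume := by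
  rw [AddCircle.volume_eq_smul_haarAddCircle]; simp

lemma four_mul_norm_le (t : AddCircle (1 : ℝ)) :
    4 * ‖t‖ ≤ ‖1 - (AddCircle.toCircle t : ℂ)‖ := by
  obtain ⟨x, hx, rfl⟩ : ∃ x : ℝ, |x| ≤ 1 / 2 ∧ (x : AddCircle (1 : ℝ)) = t := by
    induction t using QuotientAddGroup.induction_on with
    | H y =>
      refine ⟨y - round y, abs_sub_round y, ?_⟩
      have h : ((round y : ℤ) : ℝ) = (round y : ℤ) • (1 : ℝ) := by simp
      rw [h, AddCircle.coe_sub, AddCircle.coe_zsmul, AddCircle.coe_period, smul_zero, sub_zero]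
  rw [(AddCircle.norm_coe_eq_abs_iff (1 : ℝ) one_ne_zero).2 (by simpa using hx),
    AddCircle.toCircle_apply_mk, Circle.coe_exp, norm_sub_rev, mul_comm _ I,
    Complex.norm_exp_I_mul_ofReal_sub_one, norm_mul, Real.norm_eq_abs, Real.norm_eq_abs]
  have e : 2 * Real.pi / 1 * x / 2 = Real.pi * x := by ring
  rw [e]
  have hpi := Real.pi_pos
  have h := Real.mul_abs_le_abs_sin (x := Real.pi * x) (by
    rw [abs_mul, abs_of_pos hpi]; nlinarith)
  rw [abs_mul, abs_of_pos hpi] at h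
  have e2 : 2 / Real.pi * (Real.pi * |x|) = 2 * |x| := by field_simp
  rw [e2] at h
  norm_num
  linarith

lemma poissonCircle_nonneg {r : ℝ} (h0 : 0 ≤ r) (h1 : r < 1) (t : AddCircle (1 : ℝ)) :
    0 ≤ poissonCircle r t :=
  div_nonneg (by nlinarith) (by positivity)

lemma one_sub_le_norm_one_sub {r : ℝ} (h0 : 0 ≤ r) (t : AddCircle (1 : ℝ)) :
    1 - r ≤ ‖1 - (r : ℂ) * (AddCircle.toCircle t : ℂ)‖ := by
  have := norm_sub_norm_le (1 : ℂ) ((r : ℂ) * (AddCircle.toCircle t : ℂ))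
  rwa [norm_mul, Circle.norm_coe, norm_one, mul_one, Complex.norm_real, Real.norm_eq_abs,
    abs_of_nonneg h0] at this

lemma poissonCircle_le {r : ℝ} (h0 : 0 ≤ r) (h1 : r < 1) (t : AddCircle (1 : ℝ)) :
    poissonCircle r t ≤ 2 / (1 - r) := by
  have hd : 0 < 1 - r := by linarith
  have hn := one_sub_le_norm_one_sub h0 t
  have hp : 0 < ‖1 - (r : ℂ) * (AddCircle.toCircle t : ℂ)‖ := hd.trans_le hn
  rw [poissonCircle, div_le_div_iff₀ (by positivity) hd]
  have : (1 - r) ^ 2 ≤ ‖1 - (r : ℂ) * (AddCircle.toCircle t : ℂ)‖ ^ 2 := by gcongr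
  nlinarith

lemma poissonCircle_mul_sq_le {r : ℝ} (h0 : 0 ≤ r) (h1 : r < 1) (t : AddCircle (1 : ℝ)) :
    poissonCircle r t * ‖t‖ ^ 2 ≤ 1 - r := by
  have hd : 0 < 1 - r := by linarith
  have hn := one_sub_le_norm_one_sub h0 t
  set ζ : ℂ := (AddCircle.toCircle t : ℂ) with hζ
  have hζ1 : ‖ζ‖ = 1 := Circle.norm_coe _
  have h2 : ‖1 - ζ‖ ≤ 2 * ‖1 - (r : ℂ) * ζ‖ := by
    have e : 1 - ζ = (1 - (r : ℂ) * ζ) - ((1 - r : ℝ) : ℂ) * ζ := by push_cast; ring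
    rw [e]
    refine (norm_sub_le _ _).trans ?_
    rw [norm_mul, hζ1, Complex.norm_real, Real.norm_eq_abs, abs_of_pos hd]
    linarith
  have h4 := four_mul_norm_le t
  have h3 : 2 * ‖t‖ ≤ ‖1 - (r : ℂ) * ζ‖ := by linarith
  have h5 : (2 * ‖t‖) ^ 2 ≤ ‖1 - (r : ℂ) * ζ‖ ^ 2 := by gcongr
  have hp : 0 < ‖1 - (r : ℂ) * ζ‖ := hd.trans_le hn
  rw [poissonCircle, div_mul_eq_mul_div, div_le_iff₀ (by positivity)]
  nlinarith [sq_nonneg ‖t‖, mul_nonneg hd.le (sq_nonneg ‖t‖)]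

lemma exists_poissonCircle_le_dyadic {r : ℝ} (h0 : 0 ≤ r) (h1 : r < 1) (t : AddCircle (1 : ℝ)) :
    ∃ k : ℕ, ‖t‖ ≤ 2 ^ k * (1 - r) ∧ poissonCircle r t ≤ 4 / (4 ^ k * (1 - r)) := by
  have hd : 0 < 1 - r := by linarith
  have hex : ∃ k : ℕ, ‖t‖ ≤ 2 ^ k * (1 - r) := by
    obtain ⟨k, hk⟩ := pow_unbounded_of_one_lt (‖t‖ / (1 - r)) (one_lt_two (α := ℝ))
    exact ⟨k, by rw [div_lt_iff₀ hd] at hk; exact hk.le⟩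
  classical
  refine ⟨Nat.find hex, Nat.find_spec hex, ?_⟩
  rcases hk : Nat.find hex with _ | k
  · refine (poissonCircle_le h0 h1 t).trans ?_
    rw [pow_zero, one_mul]
    gcongr
    norm_num
  · have hlt : 2 ^ k * (1 - r) < ‖t‖ := by
      have := Nat.find_min hex (m := k) (by omega)
      exact not_le.1 this
    have h := poissonCircle_mul_sq_le h0 h1 t
    have h2 : (2 ^ k * (1 - r)) ^ 2 ≤ ‖t‖ ^ 2 := by gcongr
    have h3 : poissonCircle r t * (2 ^ k * (1 - r)) ^ 2 ≤ 1 - r :=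
      (mul_le_mul_of_nonneg_left h2 (poissonCircle_nonneg h0 h1 t)).trans h
    rw [le_div_iff₀ (by positivity)]
    have e : (4 : ℝ) ^ (k + 1) = 4 * (2 ^ k) ^ 2 := by
      rw [← pow_mul, mul_comm k 2, pow_mul]; norm_num; ring
    rw [e]
    have h5 : poissonCircle r t * (2 ^ k) ^ 2 * (1 - r) * (1 - r) ≤ 1 * (1 - r) := by
      linarith [h3]
    have := le_of_mul_le_mul_right h5 hd
    linarith

/-- Mass of `‖F - F θ‖` near `θ`, relative to the radius. -/
def meanOsc (F : AddCircle (1 : ℝ) → ℂ) (θ : AddCircle (1 : ℝ)) (s : ℝ) : ℝ :=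
  (∫ τ in Metric.closedBall θ s, ‖F τ - F θ‖) / s

lemma meanOsc_nonneg (F : AddCircle (1 : ℝ) → ℂ) (θ : AddCircle (1 : ℝ)) {s : ℝ}
    (hs : 0 < s) : 0 ≤ meanOsc F θ s :=
  div_nonneg (integral_nonneg fun _ => norm_nonneg _) hs.le

lemma meanOsc_le_average (F : AddCircle (1 : ℝ) → ℂ) (θ : AddCircle (1 : ℝ)) {s : ℝ}
    (hs : 0 < s) : meanOsc F θ s ≤ 2 * ⨍ τ in Metric.closedBall θ s, ‖F τ - F θ‖ := by
  rw [meanOsc, div_le_iff₀ hs, setAverage_eq, smul_eq_mul, measureReal_def,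
    AddCircle.volume_closedBall, ENNReal.toReal_ofReal (le_min zero_le_one (by linarith))]
  have hm : 0 < min 1 (2 * s) := lt_min one_pos (by linarith)
  have hI : 0 ≤ ∫ τ in Metric.closedBall θ s, ‖F τ - F θ‖ := integral_nonneg fun _ => norm_nonneg _
  have : min 1 (2 * s) ≤ 2 * s := min_le_right _ _
  calc _ = (min 1 (2 * s)) * ((min 1 (2 * s))⁻¹ * ∫ τ in Metric.closedBall θ s, ‖F τ - F θ‖) := by
        field_simp
    _ ≤ (2 * s) * ((min 1 (2 * s))⁻¹ * ∫ τ in Metric.closedBall θ s, ‖F τ - F θ‖) := by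
        gcongr
    _ = _ := by ring

lemma ae_tendsto_meanOsc {F : AddCircle (1 : ℝ) → ℂ} (hF : Integrable F) :
    ∀ᵐ θ, Tendsto (meanOsc F θ) (𝓝[>] 0) (𝓝 0) := by
  filter_upwards [IsUnifLocDoublingMeasure.ae_tendsto_average_norm_sub volume
    hF.locallyIntegrable 1] with θ hθ
  have h := (hθ (l := 𝓝[>] (0 : ℝ)) (fun _ => θ) id tendsto_id
    (by filter_upwards [self_mem_nhdsWithin] with s hs
        exact Metric.mem_closedBall_self (by rw [one_mul]; exact le_of_lt hs))).const_mul 2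
  rw [mul_zero] at h
  refine tendsto_of_tendsto_of_tendsto_of_le_of_le' tendsto_const_nhds h ?_ ?_
  · filter_upwards [self_mem_nhdsWithin] with s hs using meanOsc_nonneg F θ hs
  · filter_upwards [self_mem_nhdsWithin] with s hs using meanOsc_le_average F θ hs

lemma exists_meanOsc_le {F : AddCircle (1 : ℝ) → ℂ} (hF : Integrable F)
    {θ : AddCircle (1 : ℝ)} (h : Tendsto (meanOsc F θ) (𝓝[>] 0) (𝓝 0)) :
    ∃ M, ∀ s, 0 < s → meanOsc F θ s ≤ M := by
  have h1 := h.eventually (gt_mem_nhds (zero_lt_one (α := ℝ)))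
  rw [eventually_nhdsWithin_iff, Metric.eventually_nhds_iff] at h1
  obtain ⟨s0, hs0, h1⟩ := h1
  set K := ∫ τ, ‖F τ - F θ‖ with hK
  have hK0 : 0 ≤ K := integral_nonneg fun _ => norm_nonneg _
  refine ⟨max 1 (K / s0), fun s hs => ?_⟩
  rcases lt_or_ge s s0 with hlt | hge
  · exact le_max_of_le_left (h1 (by simpa [abs_of_pos hs] using hlt) hs).le
  · refine le_max_of_le_right ?_
    rw [meanOsc]
    gcongr
    exact setIntegral_le_integral (hF.sub (integrable_const _)).norm
      (Eventually.of_forall fun _ => norm_nonneg _)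

lemma norm_integral_poisson_sub_le {F : AddCircle (1 : ℝ) → ℂ} (hF : Integrable F)
    (θ : AddCircle (1 : ℝ)) {M : ℝ} (hM : ∀ s, 0 < s → meanOsc F θ s ≤ M)
    {r : ℝ} (h0 : 0 ≤ r) (h1 : r < 1) :
    ‖∫ τ, (poissonCircle r (θ - τ) : ℂ) * (F τ - F θ)‖ ≤
      ∑' k : ℕ, 4 * (1 / 2) ^ k * meanOsc F θ (2 ^ k * (1 - r)) := by
  have hd : 0 < 1 - r := by linarith
  have hs : ∀ k : ℕ, (0 : ℝ) < 2 ^ k * (1 - r) := fun k => by positivity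
  have hterm0 : ∀ k : ℕ, 0 ≤ 4 * (1 / 2 : ℝ) ^ k * meanOsc F θ (2 ^ k * (1 - r)) := fun k =>
    mul_nonneg (by positivity) (meanOsc_nonneg F θ (hs k))
  have hsum : Summable fun k : ℕ => 4 * (1 / 2 : ℝ) ^ k * meanOsc F θ (2 ^ k * (1 - r)) :=
    Summable.of_nonneg_of_le hterm0
      (fun k => mul_le_mul_of_nonneg_left (hM _ (hs k)) (by positivity))
      ((summable_geometric_two.mul_left 4).mul_right M)
  have hFi : Integrable fun τ => F τ - F θ := hF.sub (integrable_const _)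
  have key : ‖∫ τ, (poissonCircle r (θ - τ) : ℂ) * (F τ - F θ)‖ₑ ≤
      ENNReal.ofReal (∑' k : ℕ, 4 * (1 / 2) ^ k * meanOsc F θ (2 ^ k * (1 - r))) := by
    rw [ENNReal.ofReal_tsum_of_nonneg hterm0 hsum]
    calc ‖∫ τ, (poissonCircle r (θ - τ) : ℂ) * (F τ - F θ)‖ₑ
        ≤ ∫⁻ τ, ‖(poissonCircle r (θ - τ) : ℂ) * (F τ - F θ)‖ₑ := enorm_integral_le_lintegral_enorm _
      _ ≤ ∫⁻ τ, ∑' k : ℕ, ENNReal.ofReal (4 / (4 ^ k * (1 - r))) *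
            (Metric.closedBall θ (2 ^ k * (1 - r))).indicator (fun τ => ‖F τ - F θ‖ₑ) τ := by
          refine lintegral_mono fun τ => ?_
          obtain ⟨k, hk1, hk2⟩ := exists_poissonCircle_le_dyadic h0 h1 (θ - τ)
          refine le_trans ?_ (ENNReal.le_tsum k)
          rw [indicator_of_mem (by rwa [Metric.mem_closedBall, dist_comm, dist_eq_norm]), enorm_mul]
          gcongr
          rw [← ofReal_norm, Complex.norm_real, Real.norm_eq_abs,
            abs_of_nonneg (poissonCircle_nonneg h0 h1 _)]
          exact ENNReal.ofReal_le_ofReal hk2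
      _ = ∑' k : ℕ, ENNReal.ofReal (4 / (4 ^ k * (1 - r))) *
            ∫⁻ τ in Metric.closedBall θ (2 ^ k * (1 - r)), ‖F τ - F θ‖ₑ := by
          rw [lintegral_tsum]
          · refine tsum_congr fun k => ?_
            rw [lintegral_const_mul'' _ (hFi.aestronglyMeasurable.enorm.indicator
              Metric.isClosed_closedBall.measurableSet),
              lintegral_indicator Metric.isClosed_closedBall.measurableSet]
          · exact fun k => (hFi.aestronglyMeasurable.enorm.indicator
              Metric.isClosed_closedBall.measurableSet).const_mul _
      _ = _ := by
          refine tsum_congr fun k => ?_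
          rw [← ofReal_integral_norm_eq_lintegral_enorm hFi.integrableOn,
            ← ENNReal.ofReal_mul (by positivity)]
          congr 1
          rw [meanOsc]
          have e : (4 : ℝ) ^ k = 2 ^ k * 2 ^ k := by rw [← mul_pow]; norm_num
          rw [e, one_div, inv_pow]
          have := hs k
          field_simp
  rw [← ofReal_norm] at key
  exact (ENNReal.ofReal_le_ofReal_iff (tsum_nonneg hterm0)).1 key

lemma tendsto_integral_poisson_sub {F : AddCircle (1 : ℝ) → ℂ} (hF : Integrable F)
    {θ : AddCircle (1 : ℝ)} (h : Tendsto (meanOsc F θ) (𝓝[>] 0) (𝓝 0)) :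
    Tendsto (fun r : ℝ => ∫ τ, (poissonCircle r (θ - τ) : ℂ) * (F τ - F θ)) (𝓝[<] 1) (𝓝 0) := by
  obtain ⟨M, hM⟩ := exists_meanOsc_le hF h
  have hev : ∀ᶠ r : ℝ in 𝓝[<] 1, 0 ≤ r ∧ r < 1 :=
    (eventually_nhdsWithin_of_eventually_nhds (eventually_ge_nhds (zero_lt_one (α := ℝ)))).and
      self_mem_nhdsWithin
  refine squeeze_zero_norm' (a := fun r : ℝ =>
    ∑' k : ℕ, 4 * (1 / 2) ^ k * meanOsc F θ (2 ^ k * (1 - r))) ?_ ?_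
  · filter_upwards [hev] with r hr using norm_integral_poisson_sub_le hF θ hM hr.1 hr.2
  · have := tendsto_tsum_of_dominated_convergence (𝓕 := 𝓝[<] (1 : ℝ))
      (f := fun (r : ℝ) (k : ℕ) => 4 * (1 / 2) ^ k * meanOsc F θ (2 ^ k * (1 - r)))
      (g := fun _ : ℕ => (0 : ℝ)) (bound := fun k : ℕ => 4 * (1 / 2) ^ k * M)
      ((summable_geometric_two.mul_left 4).mul_right M) ?_ ?_
    · simpa using this
    · intro k
      have hk : Tendsto (fun r : ℝ => 2 ^ k * (1 - r)) (𝓝[<] 1) (𝓝[>] 0) := by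
        refine tendsto_nhdsWithin_iff.2 ⟨?_, ?_⟩
        · have : Tendsto (fun r : ℝ => 2 ^ k * (1 - r)) (𝓝 1) (𝓝 (2 ^ k * (1 - 1))) :=
            (continuous_const.mul (continuous_const.sub continuous_id)).tendsto _
          rw [sub_self, mul_zero] at this
          exact this.mono_left nhdsWithin_le_nhds
        · filter_upwards [self_mem_nhdsWithin] with r hr
          exact mul_pos (pow_pos two_pos k) (sub_pos.2 (mem_Iio.1 hr))
      simpa using (h.comp hk).const_mul (4 * (1 / 2 : ℝ) ^ k)
    · filter_upwards [hev] with r hr k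
      have hs : (0 : ℝ) < 2 ^ k * (1 - r) := mul_pos (by positivity) (sub_pos.2 hr.2)
      rw [Real.norm_eq_abs, abs_of_nonneg
        (mul_nonneg (by positivity) (meanOsc_nonneg F θ hs))]
      exact mul_le_mul_of_nonneg_left (hM _ hs) (by positivity)

/-- **Fatou's theorem** for the Hardy space. -/
theorem ae_hasRadialLimit (a : H2) :
    ∀ᵐ θ : AddCircle (1 : ℝ), HasRadialLimit (H2.eval a) θ (boundaryL2 a θ) := by
  have hF : Integrable (boundaryL2 a) AddCircle.haarAddCircle :=
    (Lp.memLp (boundaryL2 a)).integrable (by norm_num)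
  have hF' : Integrable (boundaryL2 a) volume := haarAddCircle_one_eq_volume ▸ hF
  filter_upwards [ae_tendsto_meanOsc hF'] with θ hθ
  have h := (tendsto_integral_poisson_sub hF' hθ).add_const (boundaryL2 a θ)
  rw [zero_add] at h
  refine h.congr' ?_
  filter_upwards [eventually_nhdsWithin_of_eventually_nhds
    (eventually_ge_nhds (zero_lt_one (α := ℝ))), self_mem_nhdsWithin] with r h0 h1
  have hP1 := integral_poissonCircle h0 h1 θ
  have hPi : Integrable (fun τ => (poissonCircle r (θ - τ) : ℂ)) AddCircle.haarAddCircle :=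
    Integrable.of_integral_ne_zero (by rw [hP1]; exact one_ne_zero)
  rw [H2.eval_eq_integral a h0 h1 θ hF, ← haarAddCircle_one_eq_volume]
  simp_rw [mul_sub]
  rw [integral_sub (integral_poissonCircle_mul hF h0 h1 θ).1 (hPi.mul_const _),
    integral_mul_const, hP1, one_mul, sub_add_cancel]

lemma lintegral_boundaryL2 (a : H2) :
    ∫⁻ θ, ‖boundaryL2 a θ‖ₑ ^ 2 = ENNReal.ofReal (‖a‖ ^ 2) := by
  have h : ‖boundaryL2 a‖ = ‖a‖ := boundaryL2.norm_map a
  have h2 := Lp.enorm_def (boundaryL2 a)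
  rw [eLpNorm_eq_lintegral_rpow_enorm_toReal (by norm_num) (by norm_num)] at h2
  simp only [ENNReal.toReal_ofNat, ENNReal.rpow_ofNat] at h2
  rw [← haarAddCircle_one_eq_volume, ← h, ENNReal.ofReal_pow (norm_nonneg _), ofReal_norm,
    h2, ← ENNReal.rpow_natCast, ← ENNReal.rpow_mul]
  norm_num

/-- The weight `(k + 1) ^ ((γ + 1) / 2)`. -/
def bergmanWeight (γ : ℝ) (k : ℕ) : ℝ := ((k : ℝ) + 1) ^ ((γ + 1) / 2)

lemma bergmanWeight_pos (γ : ℝ) (k : ℕ) : 0 < bergmanWeight γ k :=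
  Real.rpow_pos_of_pos (by positivity) _

/-- The finitely supported element of `H2` with coefficients `β k`, `k < N`. -/
def truncVec (β : ℕ → ℂ) (N : ℕ) : H2 := ∑ k ∈ Finset.range N, lp.single 2 k (β k)

lemma truncVec_apply (β : ℕ → ℂ) (N k : ℕ) :
    truncVec β N k = if k < N then β k else 0 := by
  rw [truncVec, lp.coeFn_sum, Finset.sum_apply]
  simp [lp.single_apply, Pi.single_apply]

lemma norm_truncVec_sq (β : ℕ → ℂ) (N : ℕ) :
    ‖truncVec β N‖ ^ 2 = ∑ k ∈ Finset.range N, ‖β k‖ ^ 2 := by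
  have h := lp.norm_rpow_eq_tsum (p := 2) (by norm_num) (truncVec β N)
  simp only [ENNReal.toReal_ofNat, Real.rpow_ofNat, truncVec_apply] at h
  rw [h, tsum_eq_sum (s := Finset.range N)]
  · exact Finset.sum_congr rfl fun k hk => by rw [if_pos (Finset.mem_range.1 hk)]
  · intro k hk
    rw [if_neg (by simpa using hk)]; simp

lemma eval_apply_truncVec {γ : ℝ} {φ : ℂ → ℂ} {T : H2 →L[ℂ] H2} (hT : IsCompOpBergman γ φ T)
    (β : ℕ → ℂ) (N : ℕ) {z : ℂ} (hz : z ∈ unitDisk) :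
    H2.eval (T (truncVec β N)) z =
      ∑ k ∈ Finset.range N, β k * (bergmanWeight γ k : ℂ) * φ z ^ k := by
  rw [hT _ z hz, tsum_eq_sum (s := Finset.range N)]
  · exact Finset.sum_congr rfl fun k hk => by
      rw [truncVec_apply, if_pos (Finset.mem_range.1 hk), bergmanWeight]
  · intro k hk
    rw [truncVec_apply, if_neg (by simpa using hk)]; simp

lemma mul_toCircle_mem_unitDisk {r : ℝ} (h0 : 0 ≤ r) (h1 : r < 1) (θ : AddCircle (1 : ℝ)) :
    (r : ℂ) * (AddCircle.toCircle θ : ℂ) ∈ unitDisk := by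
  rw [unitDisk, mem_ball_zero_iff, norm_mul, Circle.norm_coe, mul_one, Complex.norm_real,
    Real.norm_eq_abs, abs_of_nonneg h0]
  exact h1

lemma eventually_mem_unitDisk (θ : AddCircle (1 : ℝ)) :
    ∀ᶠ r : ℝ in 𝓝[<] 1, (r : ℂ) * (AddCircle.toCircle θ : ℂ) ∈ unitDisk := by
  filter_upwards [eventually_nhdsWithin_of_eventually_nhds
    (eventually_ge_nhds (zero_lt_one (α := ℝ))), self_mem_nhdsWithin] with r h0 h1
  exact mul_toCircle_mem_unitDisk h0 h1 θ

lemma exists_boundary_symbol {γ : ℝ} {φ : ℂ → ℂ} {T : H2 →L[ℂ] H2}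
    (hT : IsCompOpBergman γ φ T) :
    ∃ ψ : AddCircle (1 : ℝ) → ℂ, Measurable ψ ∧ ∀ᵐ θ, HasRadialLimit φ θ (ψ θ) := by
  set β : ℕ → ℂ := fun k => if k = 1 then (bergmanWeight γ 1 : ℂ)⁻¹ else 0
  have hw : (bergmanWeight γ 1 : ℂ) ≠ 0 := Complex.ofReal_ne_zero.2 (bergmanWeight_pos γ 1).ne'
  refine ⟨boundaryL2 (T (truncVec β 2)), (Lp.stronglyMeasurable _).measurable, ?_⟩
  filter_upwards [ae_hasRadialLimit (T (truncVec β 2))] with θ hθ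
  refine hθ.congr' ?_
  filter_upwards [eventually_mem_unitDisk θ] with r hr
  rw [eval_apply_truncVec hT β 2 hr]
  simp [β, hw]

lemma norm_apply_truncVec_sq {γ : ℝ} {φ : ℂ → ℂ} {T : H2 →L[ℂ] H2}
    (hT : IsCompOpBergman γ φ T) {ψ : AddCircle (1 : ℝ) → ℂ}
    (hψ : ∀ᵐ θ, HasRadialLimit φ θ (ψ θ)) (β : ℕ → ℂ) (N : ℕ) :
    ∫⁻ θ, ‖∑ k ∈ Finset.range N, β k * (bergmanWeight γ k : ℂ) * ψ θ ^ k‖ₑ ^ 2 =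
      ENNReal.ofReal (‖T (truncVec β N)‖ ^ 2) := by
  rw [← lintegral_boundaryL2]
  refine lintegral_congr_ae ?_
  filter_upwards [hψ, ae_hasRadialLimit (T (truncVec β N))] with θ h1 h2
  have h3 : Tendsto (fun r : ℝ => ∑ k ∈ Finset.range N, β k * (bergmanWeight γ k : ℂ) *
      φ (r * (AddCircle.toCircle θ : ℂ)) ^ k) (𝓝[<] 1)
      (𝓝 (∑ k ∈ Finset.range N, β k * (bergmanWeight γ k : ℂ) * ψ θ ^ k)) :=
    tendsto_finsetSum _ fun k _ => (h1.pow k).const_mul _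
  have h4 := tendsto_nhds_unique (h2.congr' (by
    filter_upwards [eventually_mem_unitDisk θ] with r hr
    exact eval_apply_truncVec hT β N hr)) h3
  rw [h4]

lemma tendsto_bergmanWeight {γ : ℝ} (hγ : -1 < γ) : Tendsto (bergmanWeight γ) atTop atTop :=
  (tendsto_rpow_atTop (by linarith : 0 < (γ + 1) / 2)).comp
    (tendsto_atTop_add_const_right _ _ tendsto_natCast_atTop_atTop)

lemma ae_norm_boundary_lt_one {γ : ℝ} (hγ : -1 < γ) {φ : ℂ → ℂ}
    (hφ : MapsTo φ unitDisk unitDisk) {T : H2 →L[ℂ] H2} (hT : IsCompOpBergman γ φ T)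
    {ψ : AddCircle (1 : ℝ) → ℂ} (hm : Measurable ψ) (hψ : ∀ᵐ θ, HasRadialLimit φ θ (ψ θ)) :
    ∀ᵐ θ, ‖ψ θ‖ < 1 := by
  have hle : ∀ᵐ θ, ‖ψ θ‖ ≤ 1 := by
    filter_upwards [hψ] with θ hθ
    refine le_of_tendsto hθ.norm ?_
    filter_upwards [eventually_mem_unitDisk θ] with r hr
    exact (mem_ball_zero_iff.1 (hφ hr)).le
  set E := {θ | 1 ≤ ‖ψ θ‖} with hE
  have hEm : MeasurableSet E := measurableSet_le measurable_const hm.norm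
  suffices volume E = 0 by
    filter_upwards [measure_eq_zero_iff_ae_notMem.1 this] with θ hθ using not_le.1 hθ
  have key : ∀ k : ℕ, ENNReal.ofReal (bergmanWeight γ k) ^ 2 * volume E ≤
      ENNReal.ofReal (‖T‖ ^ 2) := fun k => by
    have h := norm_apply_truncVec_sq hT hψ (fun j => if j = k then 1 else 0) (k + 1)
    have hn : ‖T (truncVec (fun j => if j = k then 1 else 0) (k + 1))‖ ^ 2 ≤ ‖T‖ ^ 2 := by
      have h1 : ‖truncVec (fun j => if j = k then 1 else 0) (k + 1)‖ ^ 2 = 1 := by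
        rw [norm_truncVec_sq, Finset.sum_eq_single k]
        · simp
        · intro j _ hj; simp [hj]
        · simp
      have h2 := T.le_opNorm (truncVec (fun j => if j = k then 1 else 0) (k + 1))
      calc _ ≤ (‖T‖ * ‖truncVec (fun j => if j = k then 1 else 0) (k + 1)‖) ^ 2 := by gcongr
        _ = _ := by rw [mul_pow, h1, mul_one]
    refine le_trans ?_ (h.le.trans (ENNReal.ofReal_le_ofReal hn))
    rw [← setLIntegral_const]
    refine (setLIntegral_mono' hEm fun θ hθ => ?_).trans (setLIntegral_le_lintegral E _)
    rw [Finset.sum_eq_single k]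
    · simp only [if_true, one_mul, enorm_mul, enorm_pow]
      have h1 : (1 : ℝ≥0∞) ≤ ‖ψ θ‖ₑ := by
        rw [← ofReal_norm, ← ENNReal.ofReal_one]
        exact ENNReal.ofReal_le_ofReal hθ
      have h2 : ‖(bergmanWeight γ k : ℂ)‖ₑ = ENNReal.ofReal (bergmanWeight γ k) := by
        rw [← ofReal_norm, Complex.norm_real, Real.norm_eq_abs, abs_of_pos (bergmanWeight_pos γ k)]
      rw [h2]
      gcongr
      exact le_mul_of_one_le_right' (one_le_pow₀ h1)
    · intro j _ hj; simp [hj]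
    · simp
  by_contra hne
  have hlim : Tendsto (fun k => ENNReal.ofReal (bergmanWeight γ k) ^ 2 * volume E) atTop (𝓝 ⊤) := by
    have h1 : Tendsto (fun k => ENNReal.ofReal (bergmanWeight γ k ^ 2)) atTop (𝓝 ⊤) :=
      ENNReal.tendsto_ofReal_atTop.comp
        ((tendsto_pow_atTop two_ne_zero).comp (tendsto_bergmanWeight hγ))
    simp_rw [ENNReal.ofReal_pow (bergmanWeight_pos γ _).le] at h1
    have := ENNReal.Tendsto.mul_const (b := volume E) h1 (Or.inl ENNReal.top_ne_zero)
    rwa [ENNReal.top_mul hne] at this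
  exact absurd (le_of_tendsto' hlim key) (by simp)

lemma pullbackMeasure_eq {φ : ℂ → ℂ} {ψ : AddCircle (1 : ℝ) → ℂ}
    (hψ : ∀ᵐ θ, HasRadialLimit φ θ (ψ θ)) (S : Set ℂ) :
    pullbackMeasure φ S = volume (ψ ⁻¹' S) := by
  refine measure_congr ?_
  filter_upwards [hψ] with θ hθ
  refine propext ⟨?_, fun h => ⟨_, h, hθ⟩⟩
  rintro ⟨w, hw, h⟩
  change ψ θ ∈ S
  rw [tendsto_nhds_unique hθ h]
  exact hw

lemma lintegral_comp_toCircle (F : ℂ → ℝ≥0∞) :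
    ∫⁻ x in Ioo (-Real.pi) Real.pi, F (Real.cos x + Real.sin x * I) =
      ENNReal.ofReal (2 * Real.pi) *
        ∫⁻ θ : AddCircle (1 : ℝ), F (AddCircle.toCircle θ : ℂ) := by
  have hpi := Real.pi_pos
  have himg : (fun x : ℝ => 2 * Real.pi * x) '' Ioc (-1 / 2) (-1 / 2 + 1) =
      Ioc (-Real.pi) Real.pi := by
    rw [Set.image_mul_left_Ioc (by positivity)]
    congr 1 <;> ring
  have h := lintegral_image_eq_lintegral_abs_deriv_mul (s := Ioc (-1 / 2 : ℝ) (-1 / 2 + 1))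
    (f := fun x : ℝ => 2 * Real.pi * x) (f' := fun _ => 2 * Real.pi) measurableSet_Ioc
    (fun x _ => by simpa using ((hasDerivAt_id x).const_mul (2 * Real.pi)).hasDerivWithinAt)
    (fun x _ y _ hxy => mul_left_cancel₀ (by positivity) hxy)
    (fun x => F (Real.cos x + Real.sin x * I))
  rw [restrict_Ioo_eq_restrict_Ioc, ← himg, h, lintegral_const_mul' _ _ ENNReal.ofReal_ne_top,
    ← AddCircle.lintegral_preimage 1 (-1 / 2), abs_of_pos (by positivity)]
  congr 1
  refine lintegral_congr fun x => ?_
  rw [AddCircle.toCircle_apply_mk, Circle.coe_exp, div_one, Complex.exp_mul_I]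
  simp

lemma lintegral_polar {f : ℂ → ℝ≥0∞} (hf : Measurable f) :
    ∫⁻ w, f w = ∫⁻ r in Ioi (0 : ℝ), ENNReal.ofReal (2 * Real.pi * r) *
      ∫⁻ θ : AddCircle (1 : ℝ), f ((r : ℂ) * (AddCircle.toCircle θ : ℂ)) := by
  rw [← Complex.lintegral_comp_polarCoord_symm, polarCoord_target,
    Measure.volume_eq_prod, ← Measure.prod_restrict, lintegral_prod]
  · refine setLIntegral_congr_fun measurableSet_Ioi fun r (hr : 0 < r) => ?_
    simp only [Complex.polarCoord_symm_apply, smul_eq_mul]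
    rw [lintegral_const_mul' _ _ ENNReal.ofReal_ne_top,
      lintegral_comp_toCircle (fun z => f ((r : ℂ) * z)), ← mul_assoc,
      ← ENNReal.ofReal_mul hr.le, mul_comm r]
  · refine Measurable.aemeasurable ?_
    simp only [Complex.polarCoord_symm_apply, smul_eq_mul]
    fun_prop

lemma lintegral_toCircle_poly (β : ℕ → ℂ) (N : ℕ) :
    ∫⁻ θ : AddCircle (1 : ℝ), ‖∑ k ∈ Finset.range N, β k * (AddCircle.toCircle θ : ℂ) ^ k‖ₑ ^ 2 =
      ∑ k ∈ Finset.range N, ‖β k‖ₑ ^ 2 := by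
  have hT : IsCompOpBergman (-1) id (ContinuousLinearMap.id ℂ H2) := fun b z _ => by
    simp [H2.eval]
  have h := norm_apply_truncVec_sq hT (ψ := fun θ => (AddCircle.toCircle θ : ℂ))
    (Eventually.of_forall fun θ => ?_) β N
  · simp only [bergmanWeight, neg_add_cancel, zero_div, Real.rpow_zero, Complex.ofReal_one,
      mul_one] at h
    rw [h, ContinuousLinearMap.id_apply, norm_truncVec_sq,
      ENNReal.ofReal_sum_of_nonneg fun _ _ => by positivity]
    exact Finset.sum_congr rfl fun k _ => by rw [ENNReal.ofReal_pow (norm_nonneg _), ofReal_norm]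
  · have : ContinuousAt (fun r : ℝ => id ((r : ℂ) * (AddCircle.toCircle θ : ℂ))) 1 := by fun_prop
    simpa [HasRadialLimit] using this.tendsto.mono_left nhdsWithin_le_nhds

/-- Orthogonality of the monomials with respect to radial weights. -/
lemma lintegral_poly_mul_radial (c : ℕ → ℂ) (N : ℕ) {W : ℝ → ℝ≥0∞} (hW : Measurable W) :
    ∫⁻ w : ℂ, ‖∑ k ∈ Finset.range N, c k * w ^ k‖ₑ ^ 2 * W ‖w‖ =
      ∑ k ∈ Finset.range N, ‖c k‖ₑ ^ 2 *
        ∫⁻ r in Ioi (0 : ℝ), ENNReal.ofReal (2 * Real.pi * r ^ (2 * k + 1)) * W r := by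
  rw [lintegral_polar (by fun_prop)]
  have h : ∀ r ∈ Ioi (0 : ℝ), ENNReal.ofReal (2 * Real.pi * r) *
      ∫⁻ θ : AddCircle (1 : ℝ), ‖∑ k ∈ Finset.range N,
        c k * ((r : ℂ) * (AddCircle.toCircle θ : ℂ)) ^ k‖ₑ ^ 2 *
          W ‖(r : ℂ) * (AddCircle.toCircle θ : ℂ)‖ =
      ∑ k ∈ Finset.range N, ‖c k‖ₑ ^ 2 *
        (ENNReal.ofReal (2 * Real.pi * r ^ (2 * k + 1)) * W r) := fun r (hr : 0 < r) => by
    have hn : ∀ θ : AddCircle (1 : ℝ), ‖(r : ℂ) * (AddCircle.toCircle θ : ℂ)‖ = r := fun θ => by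
      rw [norm_mul, Circle.norm_coe, mul_one, Complex.norm_real, Real.norm_of_nonneg hr.le]
    simp_rw [hn, mul_pow, ← mul_assoc]
    have h2 : Measurable fun θ : AddCircle (1 : ℝ) =>
        ‖∑ k ∈ Finset.range N, c k * (r : ℂ) ^ k * (AddCircle.toCircle θ : ℂ) ^ k‖ₑ ^ 2 := by
      have : Continuous fun θ : AddCircle (1 : ℝ) =>
        ∑ k ∈ Finset.range N, c k * (r : ℂ) ^ k * (AddCircle.toCircle θ : ℂ) ^ k := by
        fun_prop
      exact this.measurable.enorm.pow_const 2
    rw [lintegral_mul_const _ h2, lintegral_toCircle_poly (fun k => c k * (r : ℂ) ^ k) N,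
      Finset.sum_mul, Finset.mul_sum]
    refine Finset.sum_congr rfl fun k _ => ?_
    have e : ‖c k * (r : ℂ) ^ k‖ₑ ^ 2 = ‖c k‖ₑ ^ 2 * ENNReal.ofReal (r ^ (2 * k)) := by
      rw [enorm_mul, mul_pow, enorm_pow, ← ofReal_norm (r : ℂ), Complex.norm_real,
        Real.norm_of_nonneg hr.le, ← pow_mul, ← ENNReal.ofReal_pow hr.le, mul_comm k]
    rw [e, show 2 * Real.pi * r ^ (2 * k + 1) = (2 * Real.pi * r) * r ^ (2 * k) by ring,
      ENNReal.ofReal_mul (p := 2 * Real.pi * r) (by positivity)]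
    ring
  rw [setLIntegral_congr_fun measurableSet_Ioi h, lintegral_finsetSum _ (by fun_prop)]
  refine Finset.sum_congr rfl fun k _ => ?_
  rw [lintegral_const_mul _ (by fun_prop)]

lemma enorm_eval_sq_mul_le (P : Polynomial ℂ) (z : ℂ) {s : ℝ} (hs : 0 < s) :
    ‖P.eval z‖ₑ ^ 2 * ENNReal.ofReal (Real.pi * s ^ 2) ≤
      ∫⁻ w in Metric.ball z s, ‖P.eval w‖ₑ ^ 2 := by
  set Q := Polynomial.taylor z P with hQ
  have hc : Q.coeff 0 = P.eval z := Polynomial.taylor_coeff_zero z P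
  have hWm : Measurable (indicator (Iio s) (1 : ℝ → ℝ≥0∞)) :=
    measurable_one.indicator measurableSet_Iio
  have h := lintegral_poly_mul_radial Q.coeff (Q.natDegree + 1) hWm
  have e1 : ∫⁻ w in Metric.ball z s, ‖P.eval w‖ₑ ^ 2 =
      ∫⁻ w : ℂ, ‖∑ k ∈ Finset.range (Q.natDegree + 1), Q.coeff k * w ^ k‖ₑ ^ 2 *
        indicator (Iio s) (1 : ℝ → ℝ≥0∞) ‖w‖ := by
    rw [← lintegral_indicator Metric.isOpen_ball.measurableSet,
      ← lintegral_add_right_eq_self _ z]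
    refine lintegral_congr fun w => ?_
    rw [← Polynomial.eval_eq_sum_range, hQ, Polynomial.taylor_eval]
    by_cases hw : ‖w‖ < s
    · rw [indicator_of_mem (by simpa using hw), indicator_of_mem (by simpa using hw)]
      simp
    · rw [indicator_of_notMem (by simpa using hw), indicator_of_notMem (by simpa using hw),
        mul_zero]
  rw [e1, h]
  refine le_trans ?_ (Finset.single_le_sum (fun _ _ => zero_le)
    (Finset.mem_range.2 (Nat.succ_pos _)))
  rw [hc]
  gcongr
  have e2 : ∀ r : ℝ, ENNReal.ofReal (2 * Real.pi * r ^ (2 * 0 + 1)) *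
      indicator (Iio s) (1 : ℝ → ℝ≥0∞) r =
      indicator (Iio s) (fun r => ENNReal.ofReal (2 * Real.pi * r)) r := fun r => by
    by_cases hr : r ∈ Iio s <;> simp [hr]
  simp_rw [e2]
  rw [lintegral_indicator measurableSet_Iio, Measure.restrict_restrict measurableSet_Iio,
    Iio_inter_Ioi, restrict_Ioo_eq_restrict_Ioc,
    ← ofReal_integral_eq_lintegral_ofReal]
  · rw [← intervalIntegral.integral_of_le hs.le, intervalIntegral.integral_const_mul,
      integral_id]
    refine ENNReal.ofReal_le_ofReal (le_of_eq ?_)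
    ring
  · exact (Continuous.integrableOn_Icc (by fun_prop)).mono_set Ioc_subset_Icc_self
  · refine (ae_restrict_iff' measurableSet_Ioc).2 (Eventually.of_forall fun r hr => ?_)
    have := hr.1
    have hpi := Real.pi_pos
    simp only [Pi.zero_apply]
    positivity

lemma two_div_pi_mul_abs_arg_le (u : ℂ) (hu : u ≠ 0) : 2 / Real.pi * |arg u| ≤ 2 * ‖u - 1‖ := by
  have hn : 0 < ‖u‖ := norm_pos_iff.2 hu
  have h1 : ‖cexp (I * (arg u : ℝ)) - 1‖ ≤ 2 * ‖u - 1‖ := by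
    have e : cexp (I * (arg u : ℝ)) - 1 = (u - 1) + ((1 - ‖u‖ : ℝ) : ℂ) * cexp (I * (arg u : ℝ)) := by
      conv_rhs => enter [1, 1]; rw [← Complex.norm_mul_exp_arg_mul_I u]
      rw [mul_comm I]
      push_cast
      ring
    rw [e]
    refine (norm_add_le _ _).trans ?_
    rw [norm_mul, mul_comm I, Complex.norm_exp_ofReal_mul_I, mul_one, Complex.norm_real,
      Real.norm_eq_abs, abs_sub_comm]
    have := abs_norm_sub_norm_le u 1
    rw [norm_one] at this
    linarith
  rw [Complex.norm_exp_I_mul_ofReal_sub_one, norm_mul, Real.norm_eq_abs, Real.norm_eq_abs,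
    abs_two] at h1
  have h2 := Real.mul_abs_le_abs_sin (x := arg u / 2) (by
    rw [abs_div, abs_two]
    have := abs_arg_le_pi u
    linarith)
  rw [abs_div, abs_two] at h2
  have : 2 / Real.pi * |arg u| = 2 * (2 / Real.pi * (|arg u| / 2)) := by ring
  rw [this]
  linarith

/-- Points of a thin annulus which are close to one another lie, after rotation, in a short
angular sector. -/
lemma abs_arg_div_le {z z₀ : ℂ} {h : ℝ} (h0 : 0 < h) (hz : z ≠ 0)
    (hz₀ : 1 - h < ‖z₀‖) (hne : z₀ ≠ 0) (hd : ‖z - z₀‖ < h / 2) : |arg (z / z₀)| ≤ 13 * h := by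
  have hpi := Real.pi_pos
  have hpi4 := Real.pi_lt_d2
  rcases le_or_gt (1 / 4) h with h1 | h1
  · have := abs_arg_le_pi (z / z₀)
    linarith
  · have hk := two_div_pi_mul_abs_arg_le (z / z₀) (div_ne_zero hz hne)
    have hp : 0 < ‖z₀‖ := norm_pos_iff.2 hne
    have e : ‖z / z₀ - 1‖ ≤ h := by
      rw [div_sub_one hne, norm_div, div_le_iff₀ hp]
      nlinarith
    rw [div_mul_eq_mul_div, div_le_iff₀ hpi] at hk
    nlinarith

/-- The overlap multiplicity in the Carleson estimate at scale `h`. -/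
def overlap (n : ℕ) (h δ : ℝ) : ℝ := if 4 / 3 * δ ≤ h then 1 else 32 * n * h

section Carleson

variable {ν : Measure ℂ} {γ h : ℝ} {A : ℝ≥0∞} {n : ℕ}

lemma norm_sub_circleExp_arg (w : ℂ) : ‖w - Circle.exp (arg w)‖ = |1 - ‖w‖| := by
  have e : w - Circle.exp (arg w) = ((‖w‖ - 1 : ℝ) : ℂ) * cexp (arg w * I) := by
    conv_lhs => enter [1]; rw [← Complex.norm_mul_exp_arg_mul_I w]
    rw [Circle.coe_exp]
    push_cast
    ring
  rw [e, norm_mul, Complex.norm_exp_ofReal_mul_I, mul_one, Complex.norm_real, Real.norm_eq_abs,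
    abs_sub_comm]

lemma norm_circleExp_sub_le (x y : ℝ) : ‖(Circle.exp x : ℂ) - Circle.exp y‖ ≤ |x - y| := by
  have e : (Circle.exp x : ℂ) - Circle.exp y =
      cexp (y * I) * (cexp (I * ((x - y : ℝ) : ℂ)) - 1) := by
    rw [Circle.coe_exp, Circle.coe_exp, mul_sub, ← Complex.exp_add, mul_one]
    push_cast
    ring_nf
  rw [e, norm_mul, Complex.norm_exp_ofReal_mul_I, one_mul]
  exact Real.norm_exp_I_mul_ofReal_sub_one_le

lemma measure_window_le {w : ℂ}
    (hν : ∀ ξ : Circle, ν {z | ‖z - ξ‖ ≤ 4 / 3 * (1 - ‖w‖)} ≤ A) :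
    ν {z | ‖z‖ < 1 ∧ 1 - ‖z‖ < h - 1 / n ∧ ‖w - z‖ < (1 - ‖z‖) / 4} ≤ A := by
  refine (measure_mono fun z hz => ?_).trans (hν (Circle.exp (arg w)))
  obtain ⟨hz1, -, hz2⟩ := hz
  have h2 := norm_sub_norm_le w z
  have h3 := norm_sub_norm_le z w
  rw [norm_sub_rev] at h3
  have h4 := norm_sub_le_norm_sub_add_norm_sub z w (Circle.exp (arg w) : ℂ)
  rw [norm_sub_circleExp_arg, abs_of_pos (by linarith), norm_sub_rev z w] at h4
  rw [mem_ofPred_eq]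
  linarith

lemma measure_cover_le (h0 : 0 < h) (h1 : h < 1) (hn : 0 < n)
    (hν : ∀ ξ : Circle, ν {z | ‖z - ξ‖ ≤ h} ≤ A) (w : ℂ) :
    ν {z | ‖z‖ < 1 ∧ 1 - ‖z‖ < h - 1 / n ∧ ‖w - z‖ < (1 - ‖z‖) / 4} ≤
      ENNReal.ofReal (32 * n * h) * A := by
  set E := {z : ℂ | ‖z‖ < 1 ∧ 1 - ‖z‖ < h - 1 / n ∧ ‖w - z‖ < (1 - ‖z‖) / 4} with hE
  rcases E.eq_empty_or_nonempty with he | ⟨z₀, hz₀⟩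
  · simp [he]
  have hn' : (0 : ℝ) < n := Nat.cast_pos.2 hn
  have hni : (0 : ℝ) < 1 / n := by positivity
  have hne : ∀ z ∈ E, z ≠ 0 := fun z hz h2 => by
    have := hz.2.1
    rw [h2, norm_zero] at this
    linarith
  have hnh : 1 < n * h := by
    have h2 : 1 / n < h := by linarith [hz₀.1, hz₀.2.1]
    rwa [div_lt_iff₀ hn', mul_comm] at h2
  set J : ℤ := ⌊13 * (n * h) + 1 / 2⌋ with hJ
  have hJ0 : 0 ≤ J := Int.floor_nonneg.2 (by linarith)
  have hJle : (J : ℝ) ≤ 13 * (n * h) + 1 / 2 := Int.floor_le _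
  have hcov : E ⊆ ⋃ j ∈ Finset.Icc (-J) J,
      {z : ℂ | ‖z - Circle.exp (arg z₀ + j / n)‖ ≤ h} := fun z hz => by
    have hd : ‖z - z₀‖ < h / 2 := by
      have h2 := norm_sub_le_norm_sub_add_norm_sub z w z₀
      rw [norm_sub_rev z w] at h2
      linarith [hz.2.1, hz.2.2, hz₀.2.1, hz₀.2.2]
    set α := arg (z / z₀) with hα
    have hαle : |α| ≤ 13 * h :=
      abs_arg_div_le h0 (hne z hz) (by linarith [hz₀.2.1]) (hne z₀ hz₀) hd
    set j : ℤ := round (n * α) with hj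
    have hj1 : |n * α - j| ≤ 1 / 2 := abs_sub_round _
    have hj2 : |α - j / n| ≤ 1 / n := by
      have e : α - j / n = (n * α - j) / n := by field_simp
      rw [e, abs_div, abs_of_pos hn']
      gcongr
      linarith
    have hj3 : |j| ≤ J := by
      rw [hJ, Int.le_floor, Int.cast_abs]
      have h3 : |(j : ℝ)| ≤ |n * α| + |n * α - j| := by
        have := abs_sub_abs_le_abs_sub (j : ℝ) (n * α)
        rw [abs_sub_comm (j : ℝ)] at this
        linarith
      rw [abs_mul, abs_of_pos hn'] at h3
      nlinarith
    refine mem_biUnion (Finset.mem_coe.2 (Finset.mem_Icc.2 (abs_le.1 hj3))) ?_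
    change _ ≤ h
    have hzα : z = (‖z‖ : ℂ) * Circle.exp (arg z₀ + α) := by
      have e1 := Complex.norm_mul_exp_arg_mul_I z₀
      have e2 := Complex.norm_mul_exp_arg_mul_I (z / z₀)
      have e3 : ‖z‖ = ‖z₀‖ * ‖z / z₀‖ := by
        rw [← norm_mul, mul_div_cancel₀ _ (hne z₀ hz₀)]
      calc z = z₀ * (z / z₀) := (mul_div_cancel₀ _ (hne z₀ hz₀)).symm
        _ = (‖z₀‖ * cexp (arg z₀ * I)) * (‖z / z₀‖ * cexp (α * I)) := by rw [e1, e2]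
        _ = _ := by
          rw [e3, Circle.exp_add, Circle.coe_mul, Circle.coe_exp, Circle.coe_exp]
          push_cast
          ring
    have h2 : ‖z - Circle.exp (arg z₀ + α)‖ = 1 - ‖z‖ := by
      have e : z - Circle.exp (arg z₀ + α) =
          ((‖z‖ - 1 : ℝ) : ℂ) * Circle.exp (arg z₀ + α) := by
        nth_rw 1 [hzα]
        push_cast
        ring
      rw [e, norm_mul, Circle.norm_coe, mul_one, Complex.norm_real, Real.norm_eq_abs,
        abs_sub_comm, abs_of_pos (by linarith [hz.1])]
    have h3 := norm_circleExp_sub_le (arg z₀ + α) (arg z₀ + j / n)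
    rw [add_sub_add_left_eq_sub] at h3
    have h4 := norm_sub_le_norm_sub_add_norm_sub z (Circle.exp (arg z₀ + α) : ℂ)
      (Circle.exp (arg z₀ + j / n))
    linarith [hz.2.1]
  refine (measure_mono hcov).trans ((measure_biUnion_finset_le _ _).trans ?_)
  refine (Finset.sum_le_sum fun j _ => hν _).trans ?_
  rw [Finset.sum_const, nsmul_eq_mul, Int.card_Icc]
  gcongr
  rw [← ENNReal.ofReal_natCast]
  refine ENNReal.ofReal_le_ofReal ?_
  have e : ((J + 1 - -J).toNat : ℝ) = 2 * J + 1 := by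
    have : ((J + 1 - -J).toNat : ℤ) = 2 * J + 1 := by omega
    exact_mod_cast this
  rw [e]
  linarith

end Carleson

lemma overlap_nonneg {n : ℕ} {h : ℝ} (h0 : 0 < h) (δ : ℝ) : 0 ≤ overlap n h δ := by
  unfold overlap
  split_ifs <;> positivity

lemma measurable_overlap (n : ℕ) (h : ℝ) : Measurable (overlap n h) :=
  Measurable.ite (measurableSet_le (by fun_prop) measurable_const) measurable_const
    measurable_const

section Carleson

variable {ν : Measure ℂ} {γ h : ℝ} {A : ℝ≥0∞} {n : ℕ}

lemma measure_near_le (hγ : -1 < γ) (h0 : 0 < h) (h1 : h < 1) (hn : 0 < n)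
    (hν : ∀ t ∈ Ioc 0 h, ∀ ξ : Circle,
      ν {z | ‖z - ξ‖ ≤ t} ≤ A * ENNReal.ofReal (t ^ (2 + γ))) {w : ℂ} (hw : ‖w‖ < 1) :
    ν {z | ‖z‖ < 1 ∧ 1 - ‖z‖ < h - 1 / n ∧ ‖w - z‖ < (1 - ‖z‖) / 4} ≤
      A * ENNReal.ofReal (overlap n h (1 - ‖w‖) * (4 / 3 * (1 - ‖w‖)) ^ (2 + γ)) := by
  unfold overlap
  split_ifs with hd
  · rw [one_mul]
    exact measure_window_le (hν _ ⟨by linarith, hd⟩)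
  · refine (measure_cover_le h0 h1 hn (hν h ⟨h0, le_rfl⟩) w).trans ?_
    rw [mul_left_comm, ← ENNReal.ofReal_mul (by positivity)]
    gcongr
    · linarith
    · exact (not_le.1 hd).le

/-- The radial weight `(1 - r) ^ γ`, multiplied by the overlap of the Carleson windows. -/
def carlesonWeight (γ h : ℝ) (n : ℕ) : ℝ → ℝ≥0∞ :=
  indicator (Iio 1) fun r => ENNReal.ofReal (overlap n h (1 - r) * (1 - r) ^ γ)

lemma measurable_carlesonWeight : Measurable (carlesonWeight γ h n) := by
  refine Measurable.indicator ?_ measurableSet_Iio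
  have h1 := (measurable_overlap n h).comp (measurable_const.sub measurable_id : Measurable fun r : ℝ => 1 - r)
  exact (h1.mul (by fun_prop)).ennreal_ofReal

lemma setLIntegral_poly_le [SFinite ν] (hγ : -1 < γ) (h0 : 0 < h) (h1 : h < 1) (hn : 0 < n)
    (hν : ∀ t ∈ Ioc 0 h, ∀ ξ : Circle,
      ν {z | ‖z - ξ‖ ≤ t} ≤ A * ENNReal.ofReal (t ^ (2 + γ))) (P : Polynomial ℂ) :
    ∫⁻ z in {z | ‖z‖ < 1 ∧ 1 - ‖z‖ < h - 1 / n}, ‖P.eval z‖ₑ ^ 2 ∂ν ≤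
      A * ENNReal.ofReal (25 / Real.pi * (4 / 3) ^ (2 + γ)) *
        ∫⁻ w : ℂ, ‖P.eval w‖ₑ ^ 2 * carlesonWeight γ h n ‖w‖ := by
  have hpi := Real.pi_pos
  set B := {z : ℂ | ‖z‖ < 1 ∧ 1 - ‖z‖ < h - 1 / n} with hB
  have hBm : MeasurableSet B :=
    (measurableSet_lt measurable_norm measurable_const).inter
      (measurableSet_lt (f := fun z : ℂ => 1 - ‖z‖) (by fun_prop) measurable_const)
  set E : Set (ℂ × ℂ) := {p | (‖p.1‖ < 1 ∧ 1 - ‖p.1‖ < h - 1 / n) ∧ ‖p.2 - p.1‖ < (1 - ‖p.1‖) / 4}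
    with hE
  have hEm : MeasurableSet E :=
    (hBm.preimage measurable_fst).inter (measurableSet_lt
      (f := fun p : ℂ × ℂ => ‖p.2 - p.1‖) (g := fun p : ℂ × ℂ => (1 - ‖p.1‖) / 4)
      (by fun_prop) (by fun_prop))
  have hPm : Measurable fun w => ‖P.eval w‖ₑ ^ 2 := by
    have : Measurable fun w => P.eval w := P.continuous.measurable
    fun_prop
  set G : ℂ → ℝ≥0∞ := fun w => ‖P.eval w‖ₑ ^ 2 * ENNReal.ofReal (25 / (Real.pi * (1 - ‖w‖) ^ 2))
    with hG
  have hGm : Measurable G := hPm.mul (by fun_prop)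
  have hF : Measurable (E.indicator fun p => G p.2) := (hGm.comp measurable_snd).indicator hEm
  have step1 : ∀ z ∈ B, ‖P.eval z‖ₑ ^ 2 ≤ ∫⁻ w : ℂ, E.indicator (fun p => G p.2) (z, w) := by
    intro z hz
    have hs : 0 < (1 - ‖z‖) / 4 := by linarith [hz.1]
    have h2 := enorm_eval_sq_mul_le P z hs
    have hpos : 0 < Real.pi * ((1 - ‖z‖) / 4) ^ 2 := by positivity
    rw [← ENNReal.le_div_iff_mul_le (Or.inl (by simpa using hpos))
      (Or.inl ENNReal.ofReal_ne_top), div_eq_mul_inv, ← ENNReal.ofReal_inv_of_pos hpos,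
      ← lintegral_mul_const _ hPm, ← lintegral_indicator Metric.isOpen_ball.measurableSet] at h2
    refine h2.trans (lintegral_mono fun w => ?_)
    by_cases hw : w ∈ Metric.ball z ((1 - ‖z‖) / 4)
    · have hw' : ‖w - z‖ < (1 - ‖z‖) / 4 := mem_ball_iff_norm.1 hw
      rw [indicator_of_mem hw, indicator_of_mem (show (z, w) ∈ E from ⟨hz, hw'⟩)]
      refine mul_le_mul_right (ENNReal.ofReal_le_ofReal ?_) _
      have h3 := norm_sub_norm_le w z
      have h4 := norm_sub_norm_le z w
      rw [norm_sub_rev] at h4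
      have h5 : 0 < 1 - ‖w‖ := by linarith
      rw [inv_eq_one_div, div_le_div_iff₀ hpos (by positivity)]
      have h6 : (4 * (1 - ‖w‖)) ^ 2 ≤ (5 * (1 - ‖z‖)) ^ 2 :=
        pow_le_pow_left₀ (by linarith) (by linarith) 2
      nlinarith
    · rw [indicator_of_notMem hw]
      exact zero_le
  have step2 : ∀ w : ℂ, ∫⁻ z in B, E.indicator (fun p => G p.2) (z, w) ∂ν ≤
      A * ENNReal.ofReal (25 / Real.pi * (4 / 3) ^ (2 + γ)) *
        (‖P.eval w‖ₑ ^ 2 * carlesonWeight γ h n ‖w‖) := by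
    intro w
    set Ew : Set ℂ := {z | ‖z‖ < 1 ∧ 1 - ‖z‖ < h - 1 / n ∧ ‖w - z‖ < (1 - ‖z‖) / 4} with hEw
    have e : ∀ z, E.indicator (fun p => G p.2) (z, w) = Ew.indicator (fun _ => G w) z := fun z => by
      refine indicator_eq_indicator ?_ rfl
      simp only [hE, hEw, mem_ofPred_eq, and_assoc]
    have hEwm : MeasurableSet Ew := by
      have : Ew = (fun z => (z, w)) ⁻¹' E := by
        ext z
        simp only [hE, hEw, mem_ofPred_eq, mem_preimage, and_assoc]
      rw [this]
      exact hEm.preimage (by fun_prop)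
    simp_rw [e]
    refine (setLIntegral_le_lintegral B _).trans ?_
    rw [lintegral_indicator hEwm, setLIntegral_const]
    by_cases hw : ‖w‖ < 1
    · refine (mul_le_mul_right (measure_near_le hγ h0 h1 hn hν hw) _).trans (le_of_eq ?_)
      have hd : 0 < 1 - ‖w‖ := by linarith
      have hN := overlap_nonneg (n := n) h0 (1 - ‖w‖)
      rw [carlesonWeight, indicator_of_mem (show ‖w‖ ∈ Iio 1 from hw), hG]
      have e2 : 25 / (Real.pi * (1 - ‖w‖) ^ 2) *
          (overlap n h (1 - ‖w‖) * (4 / 3 * (1 - ‖w‖)) ^ (2 + γ)) =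
          25 / Real.pi * (4 / 3) ^ (2 + γ) * (overlap n h (1 - ‖w‖) * (1 - ‖w‖) ^ γ) := by
        rw [Real.mul_rpow (by norm_num) hd.le, add_comm 2 γ, Real.rpow_add hd,
          Real.rpow_two]
        field_simp
      have e3 := congrArg ENNReal.ofReal e2
      rw [ENNReal.ofReal_mul (by positivity), ENNReal.ofReal_mul (p := 25 / Real.pi * _)
        (by positivity)] at e3
      calc _ = A * ‖P.eval w‖ₑ ^ 2 * (ENNReal.ofReal (25 / (Real.pi * (1 - ‖w‖) ^ 2)) *
          ENNReal.ofReal (overlap n h (1 - ‖w‖) * (4 / 3 * (1 - ‖w‖)) ^ (2 + γ))) := by ring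
        _ = _ := by rw [e3]; ring
    · have : Ew = ∅ := by
        refine eq_empty_of_forall_notMem fun z hz => hw ?_
        have h3 := norm_sub_norm_le w z
        linarith [hz.1, hz.2.2]
      rw [this, measure_empty, mul_zero]
      exact zero_le
  calc _ ≤ ∫⁻ z in B, (∫⁻ w : ℂ, E.indicator (fun p => G p.2) (z, w)) ∂ν :=
        setLIntegral_mono' hBm step1
    _ = ∫⁻ w : ℂ, ∫⁻ z in B, E.indicator (fun p => G p.2) (z, w) ∂ν :=
        lintegral_lintegral_swap (f := fun z w => E.indicator (fun p => G p.2) (z, w))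
          hF.aemeasurable
    _ ≤ _ := lintegral_mono step2
    _ = _ := lintegral_const_mul _ (hPm.mul (measurable_carlesonWeight.comp measurable_norm))

end Carleson

lemma pow_mul_overlap_le {n k : ℕ} (hk : n ≤ k + 1) {h r : ℝ} (h0 : 0 < h) (h1 : h < 1)
    (hr0 : 0 ≤ r) (hr1 : r ≤ 1) :
    r ^ (2 * k + 1) * overlap n h (1 - r) ≤
      43 * Real.exp 1 * Real.exp (-(k + 1) * (1 - r)) := by
  have hpow : r ^ k ≤ Real.exp (-(k * (1 - r))) := by
    rw [show -(k * (1 - r)) = k * (r - 1) by ring, Real.exp_nat_mul]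
    gcongr
    linarith [Real.add_one_le_exp (r - 1)]
  have hfst : r ^ k ≤ Real.exp 1 * Real.exp (-(k + 1) * (1 - r)) := by
    refine hpow.trans ?_
    rw [← Real.exp_add]
    gcongr
    linarith
  have hsnd : r ^ k * overlap n h (1 - r) ≤ 43 := by
    unfold overlap
    split_ifs with hd
    · have := pow_le_one₀ (n := k) hr0 hr1
      linarith
    · rw [not_le] at hd
      have hk' : (n : ℝ) ≤ k + 1 := by exact_mod_cast hk
      set x := 3 / 4 * (h * k) with hx
      have hx0 : 0 ≤ x := by positivity
      have e1 : r ^ k ≤ Real.exp (-x) := hpow.trans (by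
        gcongr
        have : (0 : ℝ) ≤ k := k.cast_nonneg
        nlinarith)
      have e2 : 32 * n * h ≤ 43 * (1 + x) := by nlinarith
      have e3 : 1 + x ≤ Real.exp x := by linarith [Real.add_one_le_exp x]
      calc r ^ k * (32 * n * h) ≤ Real.exp (-x) * (43 * Real.exp x) :=
            mul_le_mul e1 (by linarith) (by positivity) (Real.exp_nonneg _)
        _ = 43 := by rw [mul_left_comm, ← Real.exp_add]; simp
  have hN := overlap_nonneg (n := n) h0 (1 - r)
  calc r ^ (2 * k + 1) * overlap n h (1 - r) = r ^ k * (r ^ k * overlap n h (1 - r)) * r := by ring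
    _ ≤ r ^ k * 43 * 1 := by gcongr
    _ ≤ _ := by linarith

lemma lintegral_carlesonWeight_le {γ : ℝ} (hγ : -1 < γ) {n k : ℕ} (hk : n ≤ k + 1) {h : ℝ}
    (h0 : 0 < h) (h1 : h < 1) :
    ∫⁻ r in Ioi (0 : ℝ), ENNReal.ofReal (2 * Real.pi * r ^ (2 * k + 1)) * carlesonWeight γ h n r ≤
      ENNReal.ofReal (86 * Real.pi * Real.exp 1 * Real.Gamma (γ + 1)) *
        ENNReal.ofReal ((1 / ((k : ℝ) + 1)) ^ (γ + 1)) := by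
  have hpi := Real.pi_pos
  have hG := Real.Gamma_pos_of_pos (by linarith : 0 < γ + 1)
  set f : ℝ → ℝ := fun x => x ^ (γ + 1 - 1) * Real.exp (-(((k : ℝ) + 1) * x)) with hf
  set F : ℝ → ℝ≥0∞ := indicator (Ioi 0) fun x => ENNReal.ofReal (f x) with hF
  have hint : ∫ x in Ioi (0 : ℝ), f x = (1 / ((k : ℝ) + 1)) ^ (γ + 1) * Real.Gamma (γ + 1) :=
    Real.integral_rpow_mul_exp_neg_mul_Ioi (by linarith) (by positivity)
  have hI : IntegrableOn f (Ioi 0) := by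
    by_contra hc
    rw [integral_undef hc] at hint
    exact absurd hint (by positivity)
  have hpt : ∀ r ∈ Ioi (0 : ℝ),
      ENNReal.ofReal (2 * Real.pi * r ^ (2 * k + 1)) * carlesonWeight γ h n r ≤
      ENNReal.ofReal (86 * Real.pi * Real.exp 1) * F (1 - r) := fun r (hr : 0 < r) => by
    by_cases hr1 : r < 1
    · have hd : 0 < 1 - r := by linarith
      rw [carlesonWeight, indicator_of_mem (show r ∈ Iio 1 from hr1), hF,
        indicator_of_mem (show 1 - r ∈ Ioi 0 from hd), ← ENNReal.ofReal_mul (by positivity),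
        ← ENNReal.ofReal_mul (by positivity)]
      refine ENNReal.ofReal_le_ofReal ?_
      have h2 := pow_mul_overlap_le hk h0 h1 hr.le hr1.le
      rw [hf]
      simp only [add_sub_cancel_right]
      calc _ = 2 * Real.pi * (1 - r) ^ γ * (r ^ (2 * k + 1) * overlap n h (1 - r)) := by ring
        _ ≤ 2 * Real.pi * (1 - r) ^ γ *
          (43 * Real.exp 1 * Real.exp (-(k + 1) * (1 - r))) := by gcongr
        _ = _ := by rw [neg_mul]; ring
    · rw [carlesonWeight, indicator_of_notMem (show r ∉ Iio 1 from hr1), mul_zero]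
      exact zero_le
  calc _ ≤ ∫⁻ r in Ioi (0 : ℝ), ENNReal.ofReal (86 * Real.pi * Real.exp 1) * F (1 - r) :=
        setLIntegral_mono' measurableSet_Ioi hpt
    _ ≤ ∫⁻ r : ℝ, ENNReal.ofReal (86 * Real.pi * Real.exp 1) * F (1 - r) :=
        setLIntegral_le_lintegral _ _
    _ = ENNReal.ofReal (86 * Real.pi * Real.exp 1) * ∫⁻ x : ℝ, F x := by
        rw [lintegral_const_mul' _ _ ENNReal.ofReal_ne_top, lintegral_sub_left_eq_self]
    _ = _ := by
        rw [lintegral_indicator measurableSet_Ioi, ← ofReal_integral_eq_lintegral_ofReal hI, hint,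
          ← ENNReal.ofReal_mul (by positivity), ← ENNReal.ofReal_mul (by positivity)]
        · congr 1
          ring
        · refine (ae_restrict_iff' measurableSet_Ioi).2 (Eventually.of_forall fun x hx => ?_)
          have hx' : 0 < x := hx
          simp only [Pi.zero_apply, hf]
          positivity

/-- The constant in the Carleson embedding estimate. -/
def carlesonConst (γ : ℝ) : ℝ :=
  25 / Real.pi * (4 / 3) ^ (2 + γ) * (86 * Real.pi * Real.exp 1 * Real.Gamma (γ + 1))

lemma carlesonConst_pos {γ : ℝ} (hγ : -1 < γ) : 0 < carlesonConst γ := by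
  have hpi := Real.pi_pos
  have hG := Real.Gamma_pos_of_pos (by linarith : 0 < γ + 1)
  unfold carlesonConst
  positivity

lemma setLIntegral_sum_le {ν : Measure ℂ} [SFinite ν] {γ h : ℝ} {A : ℝ≥0∞} {n : ℕ} (hγ : -1 < γ)
    (h0 : 0 < h) (h1 : h < 1) (hn : 0 < n)
    (hν : ∀ t ∈ Ioc 0 h, ∀ ξ : Circle,
      ν {z | ‖z - ξ‖ ≤ t} ≤ A * ENNReal.ofReal (t ^ (2 + γ))) (b : ℕ → ℂ) (N : ℕ)
    (hb : ∀ k, k + 1 < n → b k = 0) :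
    ∫⁻ z in {z | ‖z‖ < 1 ∧ 1 - ‖z‖ < h - 1 / n},
        ‖∑ k ∈ Finset.range N, b k * (bergmanWeight γ k : ℂ) * z ^ k‖ₑ ^ 2 ∂ν ≤
      A * ENNReal.ofReal (carlesonConst γ) * ∑ k ∈ Finset.range N, ‖b k‖ₑ ^ 2 := by
  have hpi := Real.pi_pos
  set c : ℕ → ℂ := fun k => b k * (bergmanWeight γ k : ℂ) with hc
  have h2 := setLIntegral_poly_le hγ h0 h1 hn hν
    (∑ k ∈ Finset.range N, Polynomial.C (c k) * Polynomial.X ^ k)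
  simp only [Polynomial.eval_finsetSum, Polynomial.eval_mul, Polynomial.eval_C,
    Polynomial.eval_pow, Polynomial.eval_X] at h2
  refine h2.trans ?_
  rw [lintegral_poly_mul_radial c N measurable_carlesonWeight, carlesonConst,
    ENNReal.ofReal_mul (p := 25 / Real.pi * (4 / 3) ^ (2 + γ)) (by positivity), mul_assoc,
    mul_assoc A, mul_assoc (ENNReal.ofReal _)]
  gcongr A * (_ * ?_)
  rw [Finset.mul_sum]
  refine Finset.sum_le_sum fun k _ => ?_
  by_cases hk : k + 1 < n
  · simp [hc, hb k hk]
  · refine (mul_le_mul_right (lintegral_carlesonWeight_le hγ (not_lt.1 hk) h0 h1) _).trans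
      (le_of_eq ?_)
    have hk0 : (0 : ℝ) < k + 1 := by positivity
    have e : ENNReal.ofReal (bergmanWeight γ k) ^ 2 *
        ENNReal.ofReal ((1 / ((k : ℝ) + 1)) ^ (γ + 1)) = 1 := by
      rw [← ENNReal.ofReal_pow (bergmanWeight_pos γ k).le, ← ENNReal.ofReal_mul (by positivity),
        bergmanWeight, ← Real.rpow_natCast, ← Real.rpow_mul hk0.le, Nat.cast_ofNat,
        div_mul_cancel₀ _ two_ne_zero, ← Real.mul_rpow hk0.le (by positivity),
        mul_one_div_cancel hk0.ne', Real.one_rpow, ENNReal.ofReal_one]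
    rw [hc, enorm_mul, mul_pow, ← ofReal_norm (bergmanWeight γ k : ℂ), Complex.norm_real,
      Real.norm_of_nonneg (bergmanWeight_pos γ k).le]
    calc _ = ‖b k‖ₑ ^ 2 * ENNReal.ofReal (86 * Real.pi * Real.exp 1 * Real.Gamma (γ + 1)) *
          (ENNReal.ofReal (bergmanWeight γ k) ^ 2 *
            ENNReal.ofReal ((1 / ((k : ℝ) + 1)) ^ (γ + 1))) := by ring
      _ = _ := by rw [e]; ring

lemma bergmanWeight_add_le {γ : ℝ} (hγ : -1 < γ) (m j : ℕ) :
    bergmanWeight γ (m + j) ≤ ((m : ℝ) + 1) ^ ((γ + 1) / 2) * bergmanWeight γ j := by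
  unfold bergmanWeight
  rw [← Real.mul_rpow (by positivity) (by positivity)]
  refine Real.rpow_le_rpow (by positivity) ?_ (by linarith)
  push_cast
  have : (0 : ℝ) ≤ m * j := by positivity
  nlinarith

lemma pow_le_exp_two_sub {r h : ℝ} (m : ℕ) (h0 : 0 ≤ r)
    (hr : h - 1 / ((m : ℝ) + 1) ≤ 1 - r) : r ^ m ≤ Real.exp (2 - (m + 1) * h) := by
  have h2 : r ≤ Real.exp (r - 1) := by linarith [Real.add_one_le_exp (r - 1)]
  calc r ^ m ≤ Real.exp (r - 1) ^ m := by gcongr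
    _ = Real.exp (m * (r - 1)) := (Real.exp_nat_mul _ _).symm
    _ ≤ _ := by
      gcongr
      have hm : (0 : ℝ) < m + 1 := by positivity
      have := mul_le_mul_of_nonneg_left hr hm.le
      rw [mul_sub, mul_one_div_cancel hm.ne'] at this
      linarith

section

variable {γ : ℝ} {φ : ℂ → ℂ} {T : H2 →L[ℂ] H2} {ψ : AddCircle (1 : ℝ) → ℂ}

lemma setLIntegral_inner_le (hγ : -1 < γ) (hT : IsCompOpBergman γ φ T)
    (hψ : ∀ᵐ θ, HasRadialLimit φ θ (ψ θ)) {m : ℕ} {h : ℝ} {s : Set (AddCircle (1 : ℝ))}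
    (hs : ∀ᵐ θ, θ ∈ s → ‖ψ θ‖ ^ m ≤ Real.exp (2 - (m + 1) * h)) (hsm : MeasurableSet s) (b : ℕ → ℂ)
    (hb : ∀ k < m, b k = 0) (M : ℕ) :
    ∫⁻ θ in s, ‖∑ k ∈ Finset.range (m + M), b k * (bergmanWeight γ k : ℂ) * ψ θ ^ k‖ₑ ^ 2 ≤
      ENNReal.ofReal (Real.exp (2 - (m + 1) * h) * (‖T‖ * (((m : ℝ) + 1) ^ ((γ + 1) / 2) *
        ‖truncVec b (m + M)‖))) ^ 2 := by
  set β : ℕ → ℂ := fun j => b (m + j) * (bergmanWeight γ (m + j) : ℂ) / (bergmanWeight γ j : ℂ)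
    with hβ
  have hw : ∀ j, (bergmanWeight γ j : ℂ) ≠ 0 := fun j =>
    Complex.ofReal_ne_zero.2 (bergmanWeight_pos γ j).ne'
  have hfac : ∀ z : ℂ, ∑ k ∈ Finset.range (m + M), b k * (bergmanWeight γ k : ℂ) * z ^ k =
      z ^ m * ∑ j ∈ Finset.range M, β j * (bergmanWeight γ j : ℂ) * z ^ j := fun z => by
    rw [Finset.sum_range_add, Finset.sum_eq_zero fun k hk => by
      rw [hb k (Finset.mem_range.1 hk), zero_mul, zero_mul], zero_add, Finset.mul_sum]
    refine Finset.sum_congr rfl fun j _ => ?_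
    rw [hβ, div_mul_cancel₀ _ (hw j), pow_add]
    ring
  have hβn : ‖truncVec β M‖ ^ 2 ≤
      (((m : ℝ) + 1) ^ ((γ + 1) / 2) * ‖truncVec b (m + M)‖) ^ 2 := by
    rw [mul_pow, norm_truncVec_sq, norm_truncVec_sq, Finset.sum_range_add, Finset.sum_eq_zero
      (s := Finset.range m) fun k hk => by rw [hb k (Finset.mem_range.1 hk)]; simp, zero_add,
      Finset.mul_sum]
    refine Finset.sum_le_sum fun j _ => ?_
    rw [← mul_pow, hβ]
    refine pow_le_pow_left₀ (norm_nonneg _) ?_ 2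
    simp only [norm_div, norm_mul, Complex.norm_real,
      Real.norm_of_nonneg (bergmanWeight_pos γ _).le]
    rw [div_le_iff₀ (bergmanWeight_pos γ j)]
    nlinarith [mul_le_mul_of_nonneg_left (bergmanWeight_add_le hγ m j) (norm_nonneg (b (m + j)))]
  have hTn : ‖T (truncVec β M)‖ ≤
      ‖T‖ * (((m : ℝ) + 1) ^ ((γ + 1) / 2) * ‖truncVec b (m + M)‖) := by
    refine (T.le_opNorm _).trans ?_
    gcongr
    exact le_of_sq_le_sq hβn (by positivity)
  calc _ ≤ ∫⁻ θ in s, ENNReal.ofReal (Real.exp (2 - (m + 1) * h)) ^ 2 *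
        ‖∑ j ∈ Finset.range M, β j * (bergmanWeight γ j : ℂ) * ψ θ ^ j‖ₑ ^ 2 := by
        refine setLIntegral_mono_ae' hsm ?_
        filter_upwards [hs] with θ hθ hmem
        rw [hfac, enorm_mul, mul_pow, ← ofReal_norm (ψ θ ^ m), norm_pow]
        gcongr
        exact hθ hmem
    _ ≤ ∫⁻ θ, ENNReal.ofReal (Real.exp (2 - (m + 1) * h)) ^ 2 *
        ‖∑ j ∈ Finset.range M, β j * (bergmanWeight γ j : ℂ) * ψ θ ^ j‖ₑ ^ 2 :=
        setLIntegral_le_lintegral _ _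
    _ = ENNReal.ofReal (Real.exp (2 - (m + 1) * h)) ^ 2 * ENNReal.ofReal ‖T (truncVec β M)‖ ^ 2 := by
        rw [lintegral_const_mul' _ _ (by simp), norm_apply_truncVec_sq hT hψ,
          ENNReal.ofReal_pow (norm_nonneg _)]
    _ ≤ _ := by
        rw [ENNReal.ofReal_mul (Real.exp_nonneg _), mul_pow]
        gcongr

/-- The supremum of `√(ρ_φ(t) / t ^ (2 + γ))` over `0 < t ≤ h`. -/
def windowSup (γ : ℝ) (φ : ℂ → ℂ) (h : ℝ) : ℝ≥0∞ :=
  ⨆ t ∈ Ioc (0 : ℝ) h, (rho φ t / ENNReal.ofReal (t ^ (2 + γ))) ^ ((1 : ℝ) / 2)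

lemma map_window_le (hm : Measurable ψ) (hψ : ∀ᵐ θ, HasRadialLimit φ θ (ψ θ)) {h t : ℝ}
    (ht : t ∈ Ioc 0 h) (ξ : Circle) :
    Measure.map ψ volume {z | ‖z - ξ‖ ≤ t} ≤
      windowSup γ φ h ^ 2 * ENNReal.ofReal (t ^ (2 + γ)) := by
  have hpos : 0 < t ^ (2 + γ) := Real.rpow_pos_of_pos ht.1 _
  rw [Measure.map_apply hm (measurableSet_le (by fun_prop) measurable_const),
    ← pullbackMeasure_eq hψ]
  have h1 : pullbackMeasure φ {z : ℂ | ‖z - ξ‖ ≤ t} ≤ rho φ t :=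
    le_iSup (fun ξ : Circle => pullbackMeasure φ {z : ℂ | ‖z - (ξ : ℂ)‖ ≤ t}) ξ
  refine h1.trans ?_
  rw [← ENNReal.div_le_iff (by simpa using hpos) ENNReal.ofReal_ne_top]
  have h2 : (rho φ t / ENNReal.ofReal (t ^ (2 + γ))) ^ ((1 : ℝ) / 2) ≤ windowSup γ φ h :=
    le_iSup₂ (f := fun t (_ : t ∈ Ioc (0 : ℝ) h) =>
      (rho φ t / ENNReal.ofReal (t ^ (2 + γ))) ^ ((1 : ℝ) / 2)) t ht
  refine le_trans (le_of_eq ?_) (pow_le_pow_left' h2 2)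
  rw [← ENNReal.rpow_natCast, ← ENNReal.rpow_mul]
  norm_num

/-- The constant in the main estimate. -/
def approxConst (γ : ℝ) (T : H2 →L[ℂ] H2) : ℝ :=
  Real.exp 2 * ‖T‖ + √(carlesonConst γ) + 1

lemma norm_apply_truncVec_le (hγ : -1 < γ) (hφ : MapsTo φ unitDisk unitDisk)
    (hT : IsCompOpBergman γ φ T) {h : ℝ} (h0 : 0 < h) (h1 : h < 1) {m : ℕ} (b : ℕ → ℂ)
    (hb : ∀ k < m, b k = 0) (M : ℕ) :
    ENNReal.ofReal ‖T (truncVec b (m + M))‖ ≤ ENNReal.ofReal (approxConst γ T) *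
      (ENNReal.ofReal (((m : ℝ) + 1 + 1) ^ ((γ + 1) / 2) * Real.exp (-((m : ℝ) + 1) * h)) +
        windowSup γ φ h) * ENNReal.ofReal ‖truncVec b (m + M)‖ := by
  obtain ⟨ψ, hm, hψ⟩ := exists_boundary_symbol hT
  have hlt := ae_norm_boundary_lt_one hγ hφ hT hm hψ
  set v := truncVec b (m + M) with hv
  set X := ((m : ℝ) + 1 + 1) ^ ((γ + 1) / 2) * Real.exp (-((m : ℝ) + 1) * h) with hX
  have hX0 : 0 ≤ X := by positivity
  set S := windowSup γ φ h
  set B := {z : ℂ | ‖z‖ < 1 ∧ 1 - ‖z‖ < h - 1 / ((m + 1 : ℕ) : ℝ)} with hB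
  have hBm : MeasurableSet B :=
    (measurableSet_lt measurable_norm measurable_const).inter
      (measurableSet_lt (f := fun z : ℂ => 1 - ‖z‖) (by fun_prop) measurable_const)
  have hC := (carlesonConst_pos hγ).le
  have hin : ∫⁻ θ in (ψ ⁻¹' B)ᶜ,
      ‖∑ k ∈ Finset.range (m + M), b k * (bergmanWeight γ k : ℂ) * ψ θ ^ k‖ₑ ^ 2 ≤
      (ENNReal.ofReal (Real.exp 2 * ‖T‖) * ENNReal.ofReal X * ENNReal.ofReal ‖v‖) ^ 2 := by
    refine (setLIntegral_inner_le (h := h) hγ hT hψ ?_ (hm hBm).compl b hb M).trans ?_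
    · filter_upwards [hlt] with θ hθ hmem
      refine pow_le_exp_two_sub m (norm_nonneg _) (not_lt.1 fun hc => hmem ⟨hθ, ?_⟩)
      push_cast
      exact hc
    · rw [← ENNReal.ofReal_mul (by positivity), ← ENNReal.ofReal_mul (by positivity)]
      refine pow_le_pow_left' (ENNReal.ofReal_le_ofReal ?_) 2
      have e : Real.exp (2 - (m + 1) * h) = Real.exp 2 * Real.exp (-((m : ℝ) + 1) * h) := by
        rw [← Real.exp_add]
        ring_nf
      have hle : ((m : ℝ) + 1) ^ ((γ + 1) / 2) ≤ ((m : ℝ) + 1 + 1) ^ ((γ + 1) / 2) :=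
        Real.rpow_le_rpow (by positivity) (by linarith) (by linarith)
      calc _ = Real.exp 2 * ‖T‖ * (((m : ℝ) + 1) ^ ((γ + 1) / 2) *
            Real.exp (-((m : ℝ) + 1) * h)) * ‖v‖ := by rw [e]; ring
        _ ≤ _ := by rw [hX]; gcongr
  have hout : ∫⁻ θ in ψ ⁻¹' B,
      ‖∑ k ∈ Finset.range (m + M), b k * (bergmanWeight γ k : ℂ) * ψ θ ^ k‖ₑ ^ 2 ≤
      (ENNReal.ofReal √(carlesonConst γ) * S * ENNReal.ofReal ‖v‖) ^ 2 := by
    have := Measure.isFiniteMeasure_map (volume : Measure (AddCircle (1 : ℝ))) ψ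
    have h2 := setLIntegral_sum_le (ν := Measure.map ψ volume) (n := m + 1) hγ h0 h1
      (Nat.succ_pos m) (fun t ht ξ => map_window_le (γ := γ) hm hψ ht ξ) b (m + M)
      (fun k hk => hb k (by omega))
    rw [setLIntegral_map hBm (by fun_prop) hm] at h2
    refine h2.trans (le_of_eq ?_)
    rw [mul_pow, mul_pow, ← ENNReal.ofReal_pow (norm_nonneg v), norm_truncVec_sq,
      ENNReal.ofReal_sum_of_nonneg fun _ _ => by positivity,
      ← ENNReal.ofReal_pow (Real.sqrt_nonneg _), Real.sq_sqrt hC, mul_comm (S ^ 2)]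
    congr 1
    exact Finset.sum_congr rfl fun k _ => by rw [ENNReal.ofReal_pow (norm_nonneg _), ofReal_norm]
  have hsum := norm_apply_truncVec_sq hT hψ b (m + M)
  rw [← lintegral_add_compl _ (hm hBm), ENNReal.ofReal_pow (norm_nonneg _)] at hsum
  rw [← ENNReal.pow_le_pow_left_iff two_ne_zero, ← hsum]
  refine (add_le_add hout hin).trans ?_
  set a₁ := ENNReal.ofReal √(carlesonConst γ)
  set a₂ := ENNReal.ofReal (Real.exp 2 * ‖T‖)
  have ha : a₂ + a₁ ≤ ENNReal.ofReal (approxConst γ T) := by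
    rw [← ENNReal.ofReal_add (by positivity) (by positivity)]
    exact ENNReal.ofReal_le_ofReal (by unfold approxConst; linarith)
  set x := ENNReal.ofReal X
  set u := ENNReal.ofReal ‖v‖
  calc (a₁ * S * u) ^ 2 + (a₂ * x * u) ^ 2 ≤ (a₁ * S * u + a₂ * x * u) ^ 2 := by
        rw [add_sq]
        gcongr
        exact le_self_add
    _ ≤ ((a₂ + a₁) * (x + S) * u) ^ 2 := by
        refine pow_le_pow_left' ?_ 2
        rw [show (a₂ + a₁) * (x + S) * u =
          a₁ * S * u + a₂ * x * u + (a₂ * S * u + a₁ * x * u) by ring]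
        exact le_self_add
    _ ≤ _ := by gcongr

end

lemma tendsto_truncVec (a : H2) (m : ℕ) :
    Tendsto (fun M => truncVec a (m + M)) atTop (𝓝 a) := by
  have h := (lp.hasSum_single (p := 2) ENNReal.ofNat_ne_top a).tendsto_sum_nat
  refine (h.comp (tendsto_add_atTop_nat m)).congr fun M => ?_
  rw [Function.comp_apply, truncVec, add_comm]

/-- The operator `T` composed with the projection onto the first `m` coordinates. -/
def headOp (T : H2 →L[ℂ] H2) (m : ℕ) : H2 →L[ℂ] H2 :=
  ∑ k ∈ Finset.range m,
    (lp.evalCLM ℂ (fun _ : ℕ => ℂ) 2 k).smulRight (T (lp.single 2 k (1 : ℂ)))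

lemma headOp_apply (T : H2 →L[ℂ] H2) (m : ℕ) (a : H2) :
    headOp T m a = T (truncVec a m) := by
  rw [headOp, _root_.sum_apply, truncVec, map_sum]
  refine Finset.sum_congr rfl fun k _ => ?_
  rw [ContinuousLinearMap.smulRight_apply, ← map_smul, ← lp.single_smul, smul_eq_mul, mul_one]
  rfl

lemma rank_headOp_le (T : H2 →L[ℂ] H2) (m : ℕ) :
    Module.rank ℂ (LinearMap.range (headOp T m : H2 →ₗ[ℂ] H2)) ≤ m := by
  classical
  set s : Finset H2 := (Finset.range m).image fun k => T (lp.single 2 k (1 : ℂ)) with hs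
  have hle : LinearMap.range (headOp T m : H2 →ₗ[ℂ] H2) ≤ Submodule.span ℂ (s : Set H2) := by
    rintro _ ⟨a, rfl⟩
    rw [ContinuousLinearMap.coe_coe, headOp, _root_.sum_apply]
    refine Submodule.sum_mem _ fun k hk => ?_
    rw [ContinuousLinearMap.smulRight_apply]
    exact Submodule.smul_mem _ _ (Submodule.subset_span
      (Finset.mem_coe.2 (Finset.mem_image_of_mem _ hk)))
  refine (Submodule.rank_mono hle).trans ((rank_span_finset_le s).trans ?_)
  have := Finset.card_image_le (s := Finset.range m) (f := fun k => T (lp.single 2 k (1 : ℂ)))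
  rw [Finset.card_range] at this
  exact_mod_cast this

lemma norm_sub_headOp_apply_le {γ : ℝ} {φ : ℂ → ℂ} {T : H2 →L[ℂ] H2} (hγ : -1 < γ)
    (hφ : MapsTo φ unitDisk unitDisk) (hT : IsCompOpBergman γ φ T) {h : ℝ} (h0 : 0 < h)
    (h1 : h < 1) (m : ℕ) (a : H2) :
    ENNReal.ofReal ‖(T - headOp T m) a‖ ≤ ENNReal.ofReal (approxConst γ T) *
      (ENNReal.ofReal (((m : ℝ) + 1 + 1) ^ ((γ + 1) / 2) * Real.exp (-((m : ℝ) + 1) * h)) +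
        windowSup γ φ h) * ENNReal.ofReal ‖a‖ := by
  set b : ℕ → ℂ := fun k => if k < m then 0 else a k with hb
  have hsub : ∀ M, truncVec b (m + M) = truncVec a (m + M) - truncVec a m := fun M => by
    ext k
    rw [lp.coeFn_sub, Pi.sub_apply, truncVec_apply, truncVec_apply, truncVec_apply, hb]
    by_cases hk : k < m
    · simp [hk, show k < m + M by omega]
    · simp [hk]
  have hnorm : ∀ M, ‖truncVec b (m + M)‖ ≤ ‖a‖ := fun M => by
    refine le_of_sq_le_sq ?_ (norm_nonneg a)
    have h2 := lp.sum_rpow_le_norm_rpow (p := 2) (by norm_num) a (Finset.range (m + M))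
    simp only [ENNReal.toReal_ofNat, Real.rpow_ofNat] at h2
    rw [norm_truncVec_sq]
    refine le_trans (Finset.sum_le_sum fun k _ => ?_) h2
    rw [hb]
    dsimp only
    split_ifs
    · simp
    · exact le_rfl
  have hlim : Tendsto (fun M => ENNReal.ofReal ‖T (truncVec b (m + M))‖) atTop
      (𝓝 (ENNReal.ofReal ‖(T - headOp T m) a‖)) := by
    refine ENNReal.tendsto_ofReal (Tendsto.norm ?_)
    rw [_root_.sub_apply, headOp_apply, ← map_sub]
    simp_rw [hsub]
    exact (T.continuous.tendsto _).comp ((tendsto_truncVec a m).sub_const _)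
  refine le_of_tendsto' hlim fun M => ?_
  refine (norm_apply_truncVec_le hγ hφ hT h0 h1 b (fun k hk => if_pos hk) M).trans ?_
  gcongr
  exact hnorm M

lemma approxNum_le_of_rank_lt {n : ℕ} {T R : H2 →L[ℂ] H2}
    (hR : Module.rank ℂ (LinearMap.range (R : H2 →ₗ[ℂ] H2)) < (n : Cardinal)) :
    approxNum n T ≤ ‖T - R‖ :=
  csInf_le ⟨0, by rintro _ ⟨R, -, rfl⟩; exact norm_nonneg _⟩ ⟨R, hR, rfl⟩

/-- if `γ > -1` and `C_φ : B_γ → H²` is bounded, then for some `C > 0`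
and all `n ≥ 1`,
`a_n(C_φ) ≤ C · inf_{0<h<1} ((n+1)^{(γ+1)/2} e^{-nh} + sup_{0<t≤h} √(ρ_φ(t)/t^{2+γ}))`. -/
theorem stmt_5 (γ : ℝ) (hγ : -1 < γ) (φ : ℂ → ℂ) (hφ : IsSymbol φ)
    (T : H2 →L[ℂ] H2) (hT : IsCompOpBergman γ φ T) :
    ∃ C > (0 : ℝ), ∀ n : ℕ, 1 ≤ n → ∀ h : ℝ, 0 < h → h < 1 →
      ENNReal.ofReal (approxNum n T) ≤
        ENNReal.ofReal C *
          (ENNReal.ofReal (((n : ℝ) + 1) ^ ((γ + 1) / 2) * Real.exp (-(n : ℝ) * h)) +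
            ⨆ t ∈ Set.Ioc (0 : ℝ) h,
              (rho φ t / ENNReal.ofReal (t ^ (2 + γ))) ^ ((1 : ℝ) / 2)) := by
  have hC : 0 < approxConst γ T := by unfold approxConst; positivity
  refine ⟨approxConst γ T, hC, fun n hn h h0 h1 => ?_⟩
  obtain ⟨m, rfl⟩ : ∃ m, n = m + 1 := ⟨n - 1, by omega⟩
  push_cast
  change _ ≤ _ * (_ + windowSup γ φ h)
  set K := ENNReal.ofReal (approxConst γ T) *
    (ENNReal.ofReal (((m : ℝ) + 1 + 1) ^ ((γ + 1) / 2) * Real.exp (-((m : ℝ) + 1) * h)) +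
      windowSup γ φ h) with hK
  rcases eq_or_ne K ⊤ with hK' | hK'
  · rw [hK']
    exact le_top
  refine ENNReal.ofReal_le_of_le_toReal ((approxNum_le_of_rank_lt
    ((rank_headOp_le T m).trans_lt (by exact_mod_cast m.lt_succ_self))).trans
    (ContinuousLinearMap.opNorm_le_bound _ ENNReal.toReal_nonneg fun a => ?_))
  have h2 := norm_sub_headOp_apply_le hγ hφ.mapsTo hT h0 h1 m a
  rw [← hK, ← ENNReal.ofReal_toReal hK', ← ENNReal.ofReal_mul ENNReal.toReal_nonneg] at h2
  exact (ENNReal.ofReal_le_ofReal_iff (by positivity)).1 h2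

end
end

section
/- Let N ≥ 2, let 0 < θ < 1 with θ > 1/N, and let Φ: D^N → D^N be defined by Φ(z₁, …, z_N) = (λ_θ(z₁), λ_θ(z₁), …, λ_θ(z₁)). Then the composition map f ↦ f ∘ Φ is not a bounded operator on H²(D^N). -/
open Complex MeasureTheory Set Filter
open scoped ENNReal Topology

noncomputable section

/-- A product of geometric series, as a sum over multi-indices. -/
theorem hasSum_prod_pow {N : ℕ} (x : Fin N → ℝ) (h0 : ∀ i, 0 ≤ x i) (h1 : ∀ i, x i < 1) :
    HasSum (fun α : Fin N → ℕ => ∏ i, x i ^ α i) (∏ i, (1 - x i)⁻¹) := by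
  induction N with
  | zero => simp
  | succ n ih =>
    have hg := hasSum_geometric_of_lt_one (h0 0) (h1 0)
    have ht := ih (fun i => x i.succ) (fun i => h0 _) (fun i => h1 _)
    have hs := Summable.mul_of_nonneg hg.summable ht.summable
      (fun k => pow_nonneg (h0 0) k)
      (fun α => Finset.prod_nonneg fun i _ => pow_nonneg (h0 _) _)
    have hm := hg.mul ht hs
    rw [Fin.prod_univ_succ, ← (Fin.consEquiv fun _ : Fin (n + 1) => ℕ).hasSum_iff]
    simpa [Function.comp_def, Fin.prod_univ_succ, Fin.consEquiv] using hm

/-- The reproducing kernel of `H²(𝔻^N)` at a point `x ∈ [0, 1)^N`. -/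
def realKernel {N : ℕ} (x : Fin N → ℝ) (h0 : ∀ i, 0 ≤ x i) (h1 : ∀ i, x i < 1) : H2poly N :=
  ⟨fun α => ((∏ i, x i ^ α i : ℝ) : ℂ), by
    refine memℓp_gen ?_
    have h := hasSum_prod_pow (fun i => x i ^ 2) (fun i => sq_nonneg _)
      (fun i => pow_lt_one₀ (h0 i) (h1 i) two_ne_zero)
    refine h.summable.congr fun α => ?_
    rw [Complex.norm_real, ENNReal.toReal_ofNat, Real.rpow_ofNat, Real.norm_eq_abs, sq_abs,
      ← Finset.prod_pow]
    exact Finset.prod_congr rfl fun i _ => by ring⟩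

theorem eval_eq_inner_realKernel {N : ℕ} (x : Fin N → ℝ) (h0 : ∀ i, 0 ≤ x i)
    (h1 : ∀ i, x i < 1) (a : H2poly N) :
    H2poly.eval a (fun i => (x i : ℂ)) = inner ℂ (realKernel x h0 h1) a := by
  rw [lp.inner_eq_tsum, H2poly.eval]
  refine tsum_congr fun α => ?_
  simp [realKernel]

theorem norm_realKernel_sq {N : ℕ} (x : Fin N → ℝ) (h0 : ∀ i, 0 ≤ x i) (h1 : ∀ i, x i < 1) :
    ‖realKernel x h0 h1‖ ^ 2 = ∏ i, (1 - x i ^ 2)⁻¹ := by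
  have h := hasSum_prod_pow (fun i => x i ^ 2) (fun i => sq_nonneg _)
    (fun i => pow_lt_one₀ (h0 i) (h1 i) two_ne_zero)
  have h2 := lp.norm_rpow_eq_tsum (p := 2) (by norm_num) (realKernel x h0 h1)
  rw [ENNReal.toReal_ofNat, Real.rpow_ofNat] at h2
  rw [h2, ← h.tsum_eq]
  refine tsum_congr fun α => ?_
  rw [realKernel, Complex.norm_real, Real.rpow_ofNat, Real.norm_eq_abs, sq_abs,
    ← Finset.prod_pow]
  exact Finset.prod_congr rfl fun i _ => by ring

/-- The lens map sends `1 - s` to `1 - u` with `0 < u ≤ 2 s ^ θ`. -/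
theorem lens_one_sub {θ s : ℝ} (hθ : 0 < θ) (hs0 : 0 < s) (hs1 : s < 1) :
    ∃ w : ℝ, 0 ≤ w ∧ w < 1 ∧ 1 - w ≤ 2 * s ^ θ ∧ lens θ ((1 - s : ℝ) : ℂ) = w := by
  have hs : 0 < s ^ θ := Real.rpow_pos_of_pos hs0 θ
  have hb : 1 ≤ (2 - s) ^ θ := Real.one_le_rpow (by linarith) hθ.le
  have hsb : s ^ θ ≤ (2 - s) ^ θ := Real.rpow_le_rpow hs0.le (by linarith) hθ.le
  refine ⟨((2 - s) ^ θ - s ^ θ) / ((2 - s) ^ θ + s ^ θ), ?_, ?_, ?_, ?_⟩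
  · exact div_nonneg (by linarith) (by linarith)
  · rw [div_lt_one (by linarith)]; linarith
  · rw [one_sub_div (by linarith), div_le_iff₀ (by linarith)]
    nlinarith
  · rw [lens, show (1 + ((1 - s : ℝ) : ℂ)) = ((2 - s : ℝ) : ℂ) by push_cast; ring,
      show (1 - ((1 - s : ℝ) : ℂ)) = (s : ℂ) by push_cast; ring,
      ← Complex.ofReal_cpow hs0.le, ← Complex.ofReal_cpow (by linarith)]
    push_cast
    rfl

/-- A bounded composition operator satisfies the reproducing-kernel estimate at real points. -/
theorem IsCompOpPoly.prod_kernel_le {N : ℕ} {Φ : (Fin N → ℂ) → (Fin N → ℂ)}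
    {T : H2poly N →L[ℂ] H2poly N} (hT : IsCompOpPoly Φ T) (x w : Fin N → ℝ)
    (hx0 : ∀ i, 0 ≤ x i) (hx1 : ∀ i, x i < 1) (hw0 : ∀ i, 0 ≤ w i) (hw1 : ∀ i, w i < 1)
    (hΦ : Φ (fun i => (x i : ℂ)) = fun i => (w i : ℂ)) :
    ∏ i, (1 - w i ^ 2)⁻¹ ≤ ‖T‖ ^ 2 * ∏ i, (1 - x i ^ 2)⁻¹ := by
  rw [← norm_realKernel_sq x hx0 hx1, ← norm_realKernel_sq w hw0 hw1, ← mul_pow]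
  set K := realKernel w hw0 hw1
  set L := realKernel x hx0 hx1
  have h := hT K (fun i => (x i : ℂ)) fun i => by
    rw [Complex.norm_real, Real.norm_of_nonneg (hx0 i)]; exact hx1 i
  rw [hΦ, eval_eq_inner_realKernel x hx0 hx1, eval_eq_inner_realKernel w hw0 hw1] at h
  have h2 : ‖K‖ ^ 2 ≤ ‖L‖ * (‖T‖ * ‖K‖) := by
    calc ‖K‖ ^ 2 = ‖inner ℂ K K‖ := by rw [inner_self_eq_norm_sq_to_K]; simp
      _ = ‖inner ℂ L (T K)‖ := by rw [h]
      _ ≤ ‖L‖ * ‖T K‖ := norm_inner_le_norm _ _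
      _ ≤ ‖L‖ * (‖T‖ * ‖K‖) := by gcongr; exact T.le_opNorm K
  refine pow_le_pow_left₀ (norm_nonneg _) ?_ 2
  rcases (norm_nonneg K).eq_or_lt with h0 | h0
  · rw [← h0]; positivity
  · nlinarith

/-- for `N ≥ 2` and `1/N < θ < 1`, the composition map by
`Φ(z₁,…,z_N) = (λ_θ(z₁),…,λ_θ(z₁))` is not a bounded operator on `H²(𝔻^N)`. -/
theorem stmt_7 (N : ℕ) (hN : 2 ≤ N) (θ : ℝ) (hθ0 : 0 < θ) (hθ1 : θ < 1)
    (hθN : 1 / (N : ℝ) < θ) :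
    ¬ ∃ T : H2poly N →L[ℂ] H2poly N,
        IsCompOpPoly (fun z _ => lens θ (z ⟨0, by omega⟩)) T := by
  rintro ⟨T, hT⟩
  have hN0 : (0 : ℝ) < N := by positivity
  have hexp : 0 < θ * N - 1 := by
    rw [div_lt_iff₀ hN0] at hθN
    linarith
  have key : ∀ s : ℝ, 0 < s → s < 1 → 1 ≤ ‖T‖ ^ 2 * 4 ^ N * s ^ (θ * N - 1) := by
    intro s hs0 hs1
    obtain ⟨w, hw0, hw1, hws, hw⟩ := lens_one_sub hθ0 hs0 hs1
    set j : Fin N := ⟨0, by omega⟩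
    have hb := hT.prod_kernel_le (Pi.single j (1 - s)) (fun _ => w)
      (fun i => by rcases eq_or_ne i j with rfl | h <;> simp [*, hs1.le])
      (fun i => by rcases eq_or_ne i j with rfl | h <;> simp [*])
      (fun _ => hw0) (fun _ => hw1) (by simpa using funext fun _ => by simpa using hw)
    rw [Finset.prod_const, Finset.card_univ, Fintype.card_fin,
      Finset.prod_eq_single j (fun i _ h => by simp [h]) (by simp), Pi.single_eq_same] at hb
    have hu : 0 < 1 - w ^ 2 := by nlinarith
    have hsθ : 0 < s ^ θ := Real.rpow_pos_of_pos hs0 θ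
    have hu' : (1 - w ^ 2) ^ N ≤ (4 * s ^ θ) ^ N :=
      pow_le_pow_left₀ hu.le (by nlinarith) N
    have hv : s ≤ 1 - (1 - s) ^ 2 := by nlinarith
    have hinv : (1 - (1 - s) ^ 2)⁻¹ ≤ s⁻¹ := inv_anti₀ hs0 hv
    have hU : 0 < (1 - w ^ 2) ^ N := pow_pos hu N
    calc (1 : ℝ) = ((1 - w ^ 2)⁻¹) ^ N * (1 - w ^ 2) ^ N := by
          rw [inv_pow, inv_mul_cancel₀ hU.ne']
      _ ≤ (‖T‖ ^ 2 * s⁻¹) * (4 * s ^ θ) ^ N := by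
          gcongr
          exact hb.trans (by gcongr)
      _ = ‖T‖ ^ 2 * 4 ^ N * s ^ (θ * N - 1) := by
          rw [Real.rpow_sub_one hs0.ne', Real.rpow_mul_natCast hs0.le, mul_pow]
          ring
  have hlim : Tendsto (fun s : ℝ => ‖T‖ ^ 2 * 4 ^ N * s ^ (θ * N - 1)) (𝓝[>] 0) (𝓝 0) := by
    have h := ((Real.continuousAt_rpow_const 0 (θ * N - 1) (Or.inr hexp.le)).tendsto.mono_left
      (nhdsWithin_le_nhds (s := Ioi 0))).const_mul (‖T‖ ^ 2 * 4 ^ N)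
    simpa [Real.zero_rpow hexp.ne'] using h
  have h01 : ∀ᶠ s : ℝ in 𝓝[>] 0, s ∈ Ioo (0 : ℝ) 1 := Ioo_mem_nhdsGT one_pos
  have hle : (1 : ℝ) ≤ 0 := ge_of_tendsto hlim (h01.mono fun s hs => key s hs.1 hs.2)
  linarith

end
end
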